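/- arXiv:2003.08157 — 2 statements merged into one kernel-verified Lean document; each statement's English description precedes it below -/
import Mathlib

section
/- Let χ : Cl_F^+(𝔤) → ℂ^× be a finite Hecke character of a totally real field F. Then the Hecke L-function admits the expansion L(χ, s) = ∑_{ξ ∈ 𝒯[𝔤]} c_χ(ξ) ℒ(ξΔ, s) for Re(s) > 1, where 𝒯[𝔤] is the set of F_+^×-orbits of 𝔤-torsion points ξ ∈ 𝕋^𝔞[𝔤] over all fractional ideals 𝔞, ℒ(ξΔ, s) is the Lerch zeta function, and c_χ(ξ) = N𝔤^{-1} ∑_{β ∈ 𝔞/𝔤𝔞} χ_𝔞(β) ξ(-β). -/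
open scoped nonZeroDivisors
open NumberField FractionalIdeal

/-- `x ∈ F` is totally positive: every real embedding sends it to a positive real. -/
def IsTotPos (F : Type*) [Field F] (x : F) : Prop := ∀ τ : F →+* ℝ, 0 < τ x

/-- `ξ : F → ℂ` is a `𝔤`-torsion point of `𝕋^𝔞 = Hom(𝔞, ℚ̄^×)`: an additive character
of `𝔞` trivial on `𝔤𝔞`. -/
def IsTorsChar {F : Type*} [Field F] [NumberField F] (𝔤 : Ideal (𝓞 F))
    (𝔞 : FractionalIdeal (𝓞 F)⁰ F) (ξ : F → ℂ) : Prop :=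
  (∀ α ∈ 𝔞, ∀ β ∈ 𝔞, ξ (α + β) = ξ α * ξ β) ∧ ξ 0 = 1 ∧
    (∀ α ∈ 𝔞, ∀ γ ∈ (𝔤 : FractionalIdeal (𝓞 F)⁰ F) * 𝔞, ξ (α + γ) = ξ α)

theorem lseriesSummable_card_absNorm (F : Type*) [Field F] [NumberField F] {s : ℂ}
    (hs : 1 < s.re) :
    LSeriesSummable (fun n ↦ ((Nat.card {I : Ideal (𝓞 F) // Ideal.absNorm I = n} : ℝ) : ℂ)) s := by
  refine LSeriesSummable_of_sum_norm_bigO_and_nonneg (r := 1)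
    (f := fun n ↦ (Nat.card {I : Ideal (𝓞 F) // Ideal.absNorm I = n} : ℝ)) ?_
    (fun _ ↦ Nat.cast_nonneg _) zero_le_one hs
  have h := (Ideal.tendsto_norm_le_div_atTop₀ F).comp tendsto_natCast_atTop_atTop
  have h2 := h.isBigO_one ℝ
  have h3 := h2.mul (Asymptotics.isBigO_refl (fun n : ℕ ↦ (n : ℝ)) Filter.atTop)
  refine h3.congr' ?_ ?_
  · filter_upwards [Filter.eventually_gt_atTop 0] with n hn
    have hn' : (n : ℝ) ≠ 0 := by positivity
    simp only [Function.comp_apply, Nat.cast_le, ← Nat.cast_sum]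
    rw [div_mul_cancel₀ _ hn']
    congr
    rw [← add_left_inj 1, ← Ideal.card_norm_le_eq_card_norm_le_add_one,
      show Finset.Icc 1 n = Finset.Ioc 0 n from Finset.Icc_succ_left_eq_Ioc _ _,
      show 1 = Nat.card {I : Ideal (𝓞 F) // Ideal.absNorm I = 0} by
        simp [Ideal.absNorm_eq_zero_iff],
      Finset.sum_Ioc_add_eq_sum_Icc (n.zero_le),
      ← Finset.card_preimage_eq_sum_card_image_eq
        (fun k _ ↦ Ideal.finite_setOfPred_absNorm_eq k)]
    simp [Set.coe_eq_subtype]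
  · filter_upwards with n
    simp

theorem summable_absNorm_rpow (F : Type*) [Field F] [NumberField F] {σ : ℝ} (hσ : 1 < σ) :
    Summable fun I : {I : Ideal (𝓞 F) // I ≠ ⊥} ↦ (Ideal.absNorm I.1 : ℝ) ^ (-σ) := by
  have h0 : Summable fun I : Ideal (𝓞 F) ↦ (Ideal.absNorm I : ℝ) ^ (-σ) := by
    rw [← (Equiv.sigmaFiberEquiv (fun I : Ideal (𝓞 F) ↦ Ideal.absNorm I)).summable_iff]
    rw [summable_sigma_of_nonneg (fun _ ↦ by simp; positivity)]
    have hfin (n : ℕ) : Finite {I : Ideal (𝓞 F) // Ideal.absNorm I = n} :=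
      Ideal.finite_setOfPred_absNorm_eq n
    refine ⟨fun n ↦ Summable.of_finite, ?_⟩
    have h := (lseriesSummable_card_absNorm F (s := σ) (by simpa using hσ)).norm
    refine h.congr_atTop ?_
    filter_upwards [Filter.eventually_gt_atTop 0] with n hn
    rw [LSeries.norm_term_eq, if_neg hn.ne']
    have : ∀ I : {I : Ideal (𝓞 F) // Ideal.absNorm I = n},
      ((fun I : Ideal (𝓞 F) ↦ (Ideal.absNorm I : ℝ) ^ (-σ)) ∘
        (Equiv.sigmaFiberEquiv (fun I : Ideal (𝓞 F) ↦ Ideal.absNorm I))) ⟨n, I⟩ =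
        (n : ℝ) ^ (-σ) := fun I ↦ by simp [I.2]
    simp only [this, tsum_const, nsmul_eq_mul]
    simp [Real.rpow_neg, div_eq_mul_inv]
  exact h0.subtype _

section TotallyPositive

variable {F : Type*} [Field F]

theorem IsTotPos.mul {x y : F} (hx : IsTotPos F x) (hy : IsTotPos F y) : IsTotPos F (x * y) :=
  fun τ ↦ by rw [map_mul]; exact mul_pos (hx τ) (hy τ)

theorem IsTotPos.of_mul_right {x y : F} (hy : IsTotPos F y) (hxy : IsTotPos F (x * y)) :
    IsTotPos F x :=
  fun τ ↦ by
    have h := hxy τ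
    rw [map_mul] at h
    exact pos_of_mul_pos_left h (hy τ).le

theorem isTotPos_one : IsTotPos F (1 : F) := fun τ ↦ by simp

theorem IsTotPos.ne_zero [NumberField F] (htr : ∀ v : InfinitePlace F, v.IsReal) {x : F}
    (hx : IsTotPos F x) : x ≠ 0 := by
  rintro rfl
  obtain ⟨v⟩ := (inferInstance : Nonempty (InfinitePlace F))
  simpa using hx (InfinitePlace.embedding_of_isReal (htr v))

theorem exists_nat_isTotPos_add_mul [NumberField F] (x : F) {n : ℕ} (hn : 0 < n) :
    ∃ k : ℕ, IsTotPos F (x + k * n) := by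
  have : Finite (F →+* ℝ) :=
    Finite.of_injective (fun τ : F →+* ℝ ↦ (algebraMap ℝ ℂ).comp τ) fun τ τ' h ↦ by
      ext y
      simpa using RingHom.congr_fun h y
  obtain ⟨M, hM⟩ := (Set.finite_range fun τ : F →+* ℝ ↦ -τ x).bddAbove
  obtain ⟨k, hk⟩ := exists_nat_gt M
  refine ⟨k, fun τ ↦ ?_⟩
  have h1 : -τ x ≤ M := hM ⟨τ, rfl⟩
  have h2 : (k : ℝ) ≤ k * n := le_mul_of_one_le_right (by positivity) (by exact_mod_cast hn)
  rw [map_add, map_mul, map_natCast, map_natCast]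
  linarith

end TotallyPositive

section TorsionQuotient

variable {F : Type*} [Field F]

theorem FractionalIdeal.add_mem {𝔞 : FractionalIdeal (𝓞 F)⁰ F} {α β : F} (hα : α ∈ 𝔞)
    (hβ : β ∈ 𝔞) : α + β ∈ 𝔞 :=
  (𝔞 : Submodule (𝓞 F) F).add_mem hα hβ

theorem FractionalIdeal.units_mul_mem {𝔞 : FractionalIdeal (𝓞 F)⁰ F} (ε : (𝓞 F)ˣ) {α : F}
    (hα : α ∈ 𝔞) : ((ε : 𝓞 F) : F) * α ∈ 𝔞 :=
  (𝔞 : Submodule (𝓞 F) F).smul_mem (ε : 𝓞 F) hα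

/-- The quotient `𝔞/𝔤𝔞`. -/
abbrev TorsQuot (𝔤 : Ideal (𝓞 F)) (𝔞 : FractionalIdeal (𝓞 F)⁰ F) : Type _ :=
  ↥(𝔞 : Submodule (𝓞 F) F) ⧸
    (((𝔤 : FractionalIdeal (𝓞 F)⁰ F) * 𝔞 : FractionalIdeal (𝓞 F)⁰ F) :
      Submodule (𝓞 F) F).comap (𝔞 : Submodule (𝓞 F) F).subtype

/-- The class of `α ∈ 𝔞` in `𝔞/𝔤𝔞`. -/
abbrev TorsQuot.mk (𝔤 : Ideal (𝓞 F)) {𝔞 : FractionalIdeal (𝓞 F)⁰ F} (α : F) (hα : α ∈ 𝔞) :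
    TorsQuot 𝔤 𝔞 :=
  Submodule.Quotient.mk ⟨α, hα⟩

theorem TorsQuot.mk_eq_iff {𝔤 : Ideal (𝓞 F)} {𝔞 : FractionalIdeal (𝓞 F)⁰ F} {α β : F}
    (hα : α ∈ 𝔞) (hβ : β ∈ 𝔞) :
    TorsQuot.mk 𝔤 α hα = TorsQuot.mk 𝔤 β hβ ↔
      α - β ∈ (𝔤 : FractionalIdeal (𝓞 F)⁰ F) * 𝔞 :=
  Submodule.Quotient.eq _

theorem TorsQuot.exists_mk {𝔤 : Ideal (𝓞 F)} {𝔞 : FractionalIdeal (𝓞 F)⁰ F}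
    (a : TorsQuot 𝔤 𝔞) : ∃ α, ∃ hα : α ∈ 𝔞, TorsQuot.mk 𝔤 α hα = a := by
  obtain ⟨⟨α, hα⟩, rfl⟩ := Submodule.Quotient.mk_surjective _ a
  exact ⟨α, hα, rfl⟩

variable [NumberField F]

theorem FractionalIdeal.mul_mem_spanSingleton_mul {𝔞 : FractionalIdeal (𝓞 F)⁰ F} (x : F)
    {α : F} (hα : α ∈ 𝔞) : x * α ∈ spanSingleton (𝓞 F)⁰ x * 𝔞 :=
  mem_singleton_mul.2 ⟨α, hα, rfl⟩

theorem FractionalIdeal.mul_mem_spanSingleton_mul_iff {𝔞 : FractionalIdeal (𝓞 F)⁰ F} {x : F}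
    (hx : x ≠ 0) {α : F} : x * α ∈ spanSingleton (𝓞 F)⁰ x * 𝔞 ↔ α ∈ 𝔞 := by
  refine ⟨fun h ↦ ?_, mul_mem_spanSingleton_mul x⟩
  obtain ⟨y, hy, h⟩ := mem_singleton_mul.1 h
  rwa [mul_left_cancel₀ hx h]

theorem coeIdeal_mul_le_right (𝔤 : Ideal (𝓞 F)) (𝔞 : FractionalIdeal (𝓞 F)⁰ F) :
    (𝔤 : FractionalIdeal (𝓞 F)⁰ F) * 𝔞 ≤ 𝔞 :=
  (mul_le_mul_left coeIdeal_le_one 𝔞).trans (one_mul 𝔞).le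

theorem TorsQuot.card_eq_absNorm (𝔤 : Ideal (𝓞 F)) {𝔞 : FractionalIdeal (𝓞 F)⁰ F}
    (h𝔞 : 𝔞 ≠ 0) : Nat.card (TorsQuot 𝔤 𝔞) = Ideal.absNorm 𝔤 := by
  obtain ⟨d, J, hd, rfl⟩ := exists_eq_spanSingleton_mul 𝔞
  have hJ : J ≠ ⊥ := by
    rintro rfl
    simp at h𝔞
  have hd' : (algebraMap (𝓞 F) F d)⁻¹ ≠ 0 := by simpa using hd
  let f : 𝓞 F →+ F := (AddMonoidHom.mulLeft (algebraMap (𝓞 F) F d)⁻¹).comp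
    (algebraMap (𝓞 F) F : 𝓞 F →+ F)
  have hf : Function.Injective f := fun x y h ↦
    FaithfulSMul.algebraMap_injective (𝓞 F) F (mul_left_cancel₀ hd' h)
  have hmap (K : Ideal (𝓞 F)) : ((spanSingleton (𝓞 F)⁰ (algebraMap (𝓞 F) F d)⁻¹ *
      (K : FractionalIdeal (𝓞 F)⁰ F) : FractionalIdeal (𝓞 F)⁰ F) :
        Submodule (𝓞 F) F).toAddSubgroup = K.toAddSubgroup.map f := by
    ext y
    simp only [Submodule.mem_toAddSubgroup, mem_coe, mem_singleton_mul, mem_coeIdeal,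
      AddSubgroup.mem_map]
    constructor
    · rintro ⟨_, ⟨z, hz, rfl⟩, rfl⟩
      exact ⟨z, hz, rfl⟩
    · rintro ⟨z, hz, rfl⟩
      exact ⟨_, ⟨z, hz, rfl⟩, rfl⟩
  have hrel : Nat.card (TorsQuot 𝔤 (spanSingleton (𝓞 F)⁰ (algebraMap (𝓞 F) F d)⁻¹ *
      (J : FractionalIdeal (𝓞 F)⁰ F))) =
      (𝔤 * J).toAddSubgroup.relIndex J.toAddSubgroup := by
    rw [← AddSubgroup.relIndex_map_map_of_injective _ _ hf, ← hmap, ← hmap, coeIdeal_mul,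
      mul_left_comm]
    rfl
  have hJ0 : Ideal.absNorm J ≠ 0 := by rwa [Ne, Ideal.absNorm_eq_zero_iff]
  rw [hrel]
  refine Nat.eq_of_mul_eq_mul_right (Nat.pos_of_ne_zero hJ0) ?_
  rw [← map_mul, Ideal.absNorm_eq_index, Ideal.absNorm_eq_index]
  exact AddSubgroup.relIndex_mul_index (Ideal.mul_le_right : 𝔤 * J ≤ J)

theorem IsTorsChar.exists_addChar {𝔤 : Ideal (𝓞 F)} {𝔞 : FractionalIdeal (𝓞 F)⁰ F}
    {ξ : F → ℂ} (hξ : IsTorsChar 𝔤 𝔞 ξ) :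
    ∃ ψ : AddChar (TorsQuot 𝔤 𝔞) ℂ, ∀ α (hα : α ∈ 𝔞), ψ (TorsQuot.mk 𝔤 α hα) = ξ α := by
  let f : TorsQuot 𝔤 𝔞 → ℂ := fun a ↦ ξ a.exists_mk.choose
  have hf (α : F) (hα : α ∈ 𝔞) : f (TorsQuot.mk 𝔤 α hα) = ξ α := by
    obtain ⟨h1, h2⟩ := (TorsQuot.mk 𝔤 α hα).exists_mk.choose_spec
    rw [TorsQuot.mk_eq_iff] at h2
    have := hξ.2.2 α hα _ h2
    rwa [add_sub_cancel] at this
  refine ⟨⟨f, ?_, ?_⟩, hf⟩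
  · exact (hf 0 (zero_mem 𝔞)).trans hξ.2.1
  · intro a b
    obtain ⟨α, hα, rfl⟩ := a.exists_mk
    obtain ⟨β, hβ, rfl⟩ := b.exists_mk
    rw [hf, hf, ← hξ.1 α hα β hβ]
    exact hf (α + β) (FractionalIdeal.add_mem hα hβ)

theorem AddChar.exists_isTorsChar {𝔤 : Ideal (𝓞 F)} {𝔞 : FractionalIdeal (𝓞 F)⁰ F}
    (ψ : AddChar (TorsQuot 𝔤 𝔞) ℂ) :
    ∃ ξ : F → ℂ, IsTorsChar 𝔤 𝔞 ξ ∧ ∀ α (hα : α ∈ 𝔞), ξ α = ψ (TorsQuot.mk 𝔤 α hα) := by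
  classical
  let f : F → ℂ := fun α ↦ if hα : α ∈ 𝔞 then ψ (TorsQuot.mk 𝔤 α hα) else 0
  have hf (α : F) (hα : α ∈ 𝔞) : f α = ψ (TorsQuot.mk 𝔤 α hα) := dif_pos hα
  refine ⟨f, ⟨fun α hα β hβ ↦ ?_, ?_, fun α hα γ hγ ↦ ?_⟩, hf⟩
  · rw [hf α hα, hf β hβ, hf _ (FractionalIdeal.add_mem hα hβ), ← AddChar.map_add_eq_mul]
    rfl
  · rw [hf 0 (zero_mem 𝔞)]
    exact ψ.map_zero_eq_one
  · rw [hf α hα, hf _ (FractionalIdeal.add_mem hα (coeIdeal_mul_le_right 𝔤 𝔞 hγ))]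
    congr 1
    rw [TorsQuot.mk_eq_iff]
    simpa using hγ

theorem IsTorsChar.comp_mul {𝔤 : Ideal (𝓞 F)} {𝔞 𝔟 : FractionalIdeal (𝓞 F)⁰ F} {ξ : F → ℂ}
    (hξ : IsTorsChar 𝔤 𝔞 ξ) {x : F} (hx : 𝔞 = spanSingleton (𝓞 F)⁰ x * 𝔟) :
    IsTorsChar 𝔤 𝔟 fun α ↦ ξ (x * α) := by
  subst hx
  refine ⟨fun α hα β hβ ↦ ?_, ?_, fun α hα γ hγ ↦ ?_⟩
  · simp only [mul_add]
    exact hξ.1 _ (mul_mem_spanSingleton_mul x hα) _ (mul_mem_spanSingleton_mul x hβ)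
  · simpa using hξ.2.1
  · simp only [mul_add]
    refine hξ.2.2 _ (mul_mem_spanSingleton_mul x hα) _ ?_
    rw [mul_left_comm]
    exact mul_mem_spanSingleton_mul x hγ

theorem sum_reps_eq_sum_torsQuot {𝔤 : Ideal (𝓞 F)} {𝔞 𝔟 : FractionalIdeal (𝓞 F)⁰ F}
    [Fintype (TorsQuot 𝔤 𝔟)] {x : F} (hx0 : x ≠ 0) (hx : 𝔞 = spanSingleton (𝓞 F)⁰ x * 𝔟)
    {B : Finset F} (hB1 : ∀ β ∈ B, β ∈ 𝔞)
    (hB2 : ∀ α ∈ 𝔞, ∃! β, β ∈ B ∧ α - β ∈ (𝔤 : FractionalIdeal (𝓞 F)⁰ F) * 𝔞)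
    {G : F → ℂ} {X : TorsQuot 𝔤 𝔟 → ℂ}
    (hG : ∀ b (hb : b ∈ 𝔟), X (TorsQuot.mk 𝔤 b hb) = G (x * b)) :
    ∑ β ∈ B, G β = ∑ a, X a := by
  have hinv {β : F} (hβ : β ∈ B) : x⁻¹ * β ∈ 𝔟 := by
    rw [← mul_mem_spanSingleton_mul_iff hx0, mul_inv_cancel_left₀ hx0, ← hx]
    exact hB1 β hβ
  have h𝔤 : (𝔤 : FractionalIdeal (𝓞 F)⁰ F) * 𝔞 =
      spanSingleton (𝓞 F)⁰ x * ((𝔤 : FractionalIdeal (𝓞 F)⁰ F) * 𝔟) := by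
    rw [hx, mul_left_comm]
  refine Finset.sum_bij (fun β hβ ↦ TorsQuot.mk 𝔤 (x⁻¹ * β) (hinv hβ)) (fun _ _ ↦
    Finset.mem_univ _) ?_ ?_ ?_
  · intro β hβ β' hβ' h
    rw [TorsQuot.mk_eq_iff, ← mul_sub, ← mul_mem_spanSingleton_mul_iff hx0,
      mul_inv_cancel_left₀ hx0, ← h𝔤] at h
    exact (hB2 β (hB1 β hβ)).unique ⟨hβ, by rw [sub_self]; exact zero_mem _⟩ ⟨hβ', h⟩
  · intro a _
    obtain ⟨b, hb, rfl⟩ := a.exists_mk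
    obtain ⟨β, ⟨hβ, h⟩, -⟩ := hB2 (x * b) (by
      rw [hx]; exact mul_mem_spanSingleton_mul x hb)
    refine ⟨β, hβ, ?_⟩
    rw [eq_comm, TorsQuot.mk_eq_iff, ← mul_mem_spanSingleton_mul_iff hx0, mul_sub,
      mul_inv_cancel_left₀ hx0, ← h𝔤]
    exact h
  · intro β hβ
    rw [hG, mul_inv_cancel_left₀ hx0]

end TorsionQuotient

theorem AddChar.sum_fourier_inversion {A : Type*} [AddCommGroup A] [Fintype A] (X : A → ℂ)
    (a : A) :
    ∑ ψ : AddChar A ℂ, ((Fintype.card A : ℂ)⁻¹ * ∑ b, X b * ψ (-b)) * ψ a = X a := by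
  classical
  have hA : (Fintype.card A : ℂ) ≠ 0 := by simp
  calc _ = (Fintype.card A : ℂ)⁻¹ * ∑ b, X b * ∑ ψ : AddChar A ℂ, ψ (a - b) := by
        simp_rw [mul_assoc, ← Finset.mul_sum, Finset.sum_mul]
        rw [Finset.sum_comm]
        simp_rw [mul_assoc, ← AddChar.map_add_eq_mul, neg_add_eq_sub, ← Finset.mul_sum]
    _ = X a := by
        simp_rw [AddChar.sum_apply_eq_ite, sub_eq_zero]
        simp
        field_simp

section Expansion

variable {F : Type*} [Field F] [NumberField F]

theorem spanSingleton_units_mul (ε : (𝓞 F)ˣ) (x : F) :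
    spanSingleton (𝓞 F)⁰ (((ε : 𝓞 F) : F) * x) = spanSingleton (𝓞 F)⁰ x :=
  (spanSingleton_eq_spanSingleton.2 ⟨ε, rfl⟩).symm

theorem coeIdeal_eq_inv_mul_spanSingleton_iff {𝔞 : FractionalIdeal (𝓞 F)⁰ F} (h𝔞 : 𝔞 ≠ 0)
    {I : Ideal (𝓞 F)} (hI : I ≠ ⊥) {x : F} :
    (I : FractionalIdeal (𝓞 F)⁰ F) = 𝔞⁻¹ * spanSingleton (𝓞 F)⁰ x ↔
      𝔞 = spanSingleton (𝓞 F)⁰ x * (I : FractionalIdeal (𝓞 F)⁰ F)⁻¹ := by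
  have hI' : (I : FractionalIdeal (𝓞 F)⁰ F) ≠ 0 := coeIdeal_ne_zero.2 hI
  rw [eq_inv_mul_iff_mul_eq₀ h𝔞, eq_mul_inv_iff_mul_eq₀ hI']

theorem eq_spanSingleton_inv_mul_iff {𝔞 𝔟 : FractionalIdeal (𝓞 F)⁰ F} {x : F} (hx : x ≠ 0) :
    𝔟 = (spanSingleton (𝓞 F)⁰ x)⁻¹ * 𝔞 ↔ 𝔞 = spanSingleton (𝓞 F)⁰ x * 𝔟 := by
  have hx' : spanSingleton (𝓞 F)⁰ x ≠ 0 := spanSingleton_ne_zero_iff.2 hx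
  rw [eq_inv_mul_iff_mul_eq₀ hx', eq_comm]

theorem exists_coeIdeal_eq_inv_mul_spanSingleton {𝔞 : FractionalIdeal (𝓞 F)⁰ F} (h𝔞 : 𝔞 ≠ 0)
    {β : F} (hβ : β ∈ 𝔞) (hβ0 : β ≠ 0) :
    ∃ I : Ideal (𝓞 F), I ≠ ⊥ ∧
      (I : FractionalIdeal (𝓞 F)⁰ F) = 𝔞⁻¹ * spanSingleton (𝓞 F)⁰ β := by
  have hle : 𝔞⁻¹ * spanSingleton (𝓞 F)⁰ β ≤ 1 := by
    rw [← inv_mul_cancel₀ h𝔞]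
    exact mul_le_mul_right (spanSingleton_le_iff_mem.2 hβ) _
  obtain ⟨I, hI⟩ := le_one_iff_exists_coeIdeal.1 hle
  refine ⟨I, ?_, hI⟩
  rintro rfl
  rw [coeIdeal_bot, eq_comm, mul_eq_zero, spanSingleton_eq_zero_iff] at hI
  exact hI.elim (inv_ne_zero h𝔞) hβ0

theorem eq_of_spanSingleton_eq_of_reps {𝔞 : FractionalIdeal (𝓞 F)⁰ F} {R : Set F}
    (hR1 : ∀ β ∈ R, β ∈ 𝔞 ∧ IsTotPos F β)
    (hR2 : ∀ α, α ∈ 𝔞 → IsTotPos F α → ∃! β, β ∈ R ∧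
      ∃ ε : (𝓞 F)ˣ, IsTotPos F ((ε : 𝓞 F) : F) ∧ ((ε : 𝓞 F) : F) * β = α)
    {β β' : F} (hβ : β ∈ R) (hβ' : β' ∈ R)
    (h : spanSingleton (𝓞 F)⁰ β = spanSingleton (𝓞 F)⁰ β') : β = β' := by
  obtain ⟨z, hz⟩ := spanSingleton_eq_spanSingleton.1 h
  replace hz : ((z : 𝓞 F) : F) * β = β' := hz
  have hzpos : IsTotPos F ((z : 𝓞 F) : F) :=
    (hR1 β hβ).2.of_mul_right (hz ▸ (hR1 β' hβ').2)
  exact (hR2 β' (hR1 β' hβ').1 (hR1 β' hβ').2).unique ⟨hβ, z, hzpos, hz⟩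
    ⟨hβ', 1, by simpa using isTotPos_one, by simp⟩

/-- On the class of an integral ideal, the induced function `χ_𝔞` only depends on the ideal. -/
theorem inducedFun_mul_eq {χ : Ideal (𝓞 F) → ℂ} {𝔤 I : Ideal (𝓞 F)}
    {𝔞 : FractionalIdeal (𝓞 F)⁰ F} (h𝔞 : 𝔞 ≠ 0) (hI : I ≠ ⊥) {f : F → ℂ}
    (hper : ∀ α γ : F, γ ∈ (𝔤 : FractionalIdeal (𝓞 F)⁰ F) * 𝔞 → f (α + γ) = f α)
    (hval : ∀ α ∈ 𝔞, IsTotPos F α → ∀ I : Ideal (𝓞 F),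
      (I : FractionalIdeal (𝓞 F)⁰ F) = 𝔞⁻¹ * spanSingleton (𝓞 F)⁰ α → f α = χ I)
    {x : F} (hx : IsTotPos F x)
    (h : 𝔞 = spanSingleton (𝓞 F)⁰ x * (I : FractionalIdeal (𝓞 F)⁰ F)⁻¹) {b γ : F}
    (hb : b ∈ (I : FractionalIdeal (𝓞 F)⁰ F)⁻¹)
    (hγ : γ ∈ (𝔤 : FractionalIdeal (𝓞 F)⁰ F) * (I : FractionalIdeal (𝓞 F)⁰ F)⁻¹)
    (hpos : IsTotPos F (b + γ)) {J : Ideal (𝓞 F)}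
    (hJ : (J : FractionalIdeal (𝓞 F)⁰ F) = I * spanSingleton (𝓞 F)⁰ (b + γ)) :
    f (x * b) = χ J := by
  have h1 : x * γ ∈ (𝔤 : FractionalIdeal (𝓞 F)⁰ F) * 𝔞 := by
    rw [h, mul_left_comm]
    exact mul_mem_spanSingleton_mul x hγ
  rw [← hper _ _ h1, ← mul_add]
  refine hval _ ?_ (hx.mul hpos) J ?_
  · rw [h]
    exact mul_mem_spanSingleton_mul x
      (FractionalIdeal.add_mem hb (coeIdeal_mul_le_right _ _ hγ))
  · rw [hJ, (coeIdeal_eq_inv_mul_spanSingleton_iff h𝔞 hI).2 h, mul_assoc,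
      spanSingleton_mul_spanSingleton]

theorem exists_mem_isTotPos_add {𝔤 I : Ideal (𝓞 F)} (h𝔤 : 𝔤 ≠ ⊥) (hI : I ≠ ⊥) (b : F) :
    ∃ γ ∈ (𝔤 : FractionalIdeal (𝓞 F)⁰ F) * (I : FractionalIdeal (𝓞 F)⁰ F)⁻¹,
      IsTotPos F (b + γ) := by
  have hn : 0 < Ideal.absNorm 𝔤 :=
    Nat.pos_of_ne_zero (by rwa [Ne, Ideal.absNorm_eq_zero_iff])
  obtain ⟨k, hk⟩ := exists_nat_isTotPos_add_mul b hn
  refine ⟨_, ?_, hk⟩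
  rw [← mul_one ((k : F) * _)]
  refine mul_mem_mul ?_ (FractionalIdeal.one_mem_inv_coe_ideal hI)
  rw [mem_coeIdeal]
  exact ⟨(k : 𝓞 F) * Ideal.absNorm 𝔤, Ideal.mul_mem_left _ _ (Ideal.absNorm_mem 𝔤), by simp⟩

theorem TorsQuot.finite {𝔤 : Ideal (𝓞 F)} (h𝔤 : 𝔤 ≠ ⊥) {𝔞 : FractionalIdeal (𝓞 F)⁰ F}
    (h𝔞 : 𝔞 ≠ 0) : Finite (TorsQuot 𝔤 𝔞) := by
  refine Nat.finite_of_card_ne_zero ?_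
  rwa [TorsQuot.card_eq_absNorm 𝔤 h𝔞, Ne, Ideal.absNorm_eq_zero_iff]

theorem IsTorsChar.norm_eq_one {𝔤 : Ideal (𝓞 F)} (h𝔤 : 𝔤 ≠ ⊥)
    {𝔞 : FractionalIdeal (𝓞 F)⁰ F} (h𝔞 : 𝔞 ≠ 0) {ξ : F → ℂ} (hξ : IsTorsChar 𝔤 𝔞 ξ) {α : F}
    (hα : α ∈ 𝔞) : ‖ξ α‖ = 1 := by
  have := TorsQuot.finite h𝔤 h𝔞
  obtain ⟨ψ, hψ⟩ := hξ.exists_addChar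
  rw [← hψ α hα, AddChar.norm_apply]

/-- The sum over the `Δ`-orbit of a torsion point, evaluated at `β`, is a sum of values at `1` of
the characters of `I⁻¹/𝔤I⁻¹` lying above that torsion point, where `I = 𝔞⁻¹β`. -/
theorem sum_unit_orbit_eq_sum_fiber (htr : ∀ v : InfinitePlace F, v.IsReal)
    {𝔤 I : Ideal (𝓞 F)} (hI : I ≠ ⊥)
    {𝔞 : FractionalIdeal (𝓞 F)⁰ F} (h𝔞 : 𝔞 ≠ 0) {ξ : F → ℂ} (hξ : IsTorsChar 𝔤 𝔞 ξ)
    {E : Finset (𝓞 F)ˣ} (hEpos : ∀ ε ∈ E, IsTotPos F ((ε : 𝓞 F) : F))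
    (hE : ∀ ε : (𝓞 F)ˣ, IsTotPos F ((ε : 𝓞 F) : F) →
      ∃! ε' : (𝓞 F)ˣ, ε' ∈ E ∧
        ∀ α ∈ 𝔞, ξ (((ε : 𝓞 F) : F) * α) = ξ (((ε' : 𝓞 F) : F) * α))
    {β : F} (hβ : IsTotPos F β)
    (hIβ : (I : FractionalIdeal (𝓞 F)⁰ F) = 𝔞⁻¹ * spanSingleton (𝓞 F)⁰ β)
    (S : Finset (AddChar (TorsQuot 𝔤 (I : FractionalIdeal (𝓞 F)⁰ F)⁻¹) ℂ))
    (hS : ∀ ψ, ψ ∈ S ↔ ∃ x : F, IsTotPos F x ∧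
      𝔞 = spanSingleton (𝓞 F)⁰ x * (I : FractionalIdeal (𝓞 F)⁰ F)⁻¹ ∧
      ∀ α hα, ψ (TorsQuot.mk 𝔤 α hα) = ξ (x * α)) :
    ∑ ε ∈ E, ξ (((ε : 𝓞 F) : F) * β) =
      ∑ ψ ∈ S, ψ (TorsQuot.mk 𝔤 1 (FractionalIdeal.one_mem_inv_coe_ideal hI)) := by
  have hβ0 := hβ.ne_zero htr
  have h𝔞β := (coeIdeal_eq_inv_mul_spanSingleton_iff h𝔞 hI).1 hIβ
  have hspan (ε : (𝓞 F)ˣ) : 𝔞 = spanSingleton (𝓞 F)⁰ (((ε : 𝓞 F) : F) * β) *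
      (I : FractionalIdeal (𝓞 F)⁰ F)⁻¹ := by
    rwa [spanSingleton_units_mul]
  choose Ψ hΨ using fun ε : (𝓞 F)ˣ ↦ (hξ.comp_mul (hspan ε)).exists_addChar
  have hquot {α : F} (hα : α ∈ 𝔞) : β⁻¹ * α ∈ (I : FractionalIdeal (𝓞 F)⁰ F)⁻¹ := by
    rwa [← mul_mem_spanSingleton_mul_iff hβ0, mul_inv_cancel_left₀ hβ0, ← h𝔞β]
  refine Finset.sum_bij (fun ε _ ↦ Ψ ε) ?_ ?_ ?_ ?_
  · exact fun ε hε ↦ (hS _).2 ⟨_, (hEpos ε hε).mul hβ, hspan ε, hΨ ε⟩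
  · intro ε hε ε' hε' h
    refine (hE ε (hEpos ε hε)).unique ⟨hε, fun _ _ ↦ rfl⟩ ⟨hε', fun α hα ↦ ?_⟩
    have h1 := hΨ ε _ (hquot hα)
    have h2 := hΨ ε' _ (hquot hα)
    rw [h, h2, mul_assoc, mul_assoc, mul_inv_cancel_left₀ hβ0] at h1
    exact h1.symm
  · intro ψ hψ
    obtain ⟨x, hx, hax, hψx⟩ := (hS ψ).1 hψ
    have hIx := (coeIdeal_eq_inv_mul_spanSingleton_iff h𝔞 hI).2 hax
    have hsx : spanSingleton (𝓞 F)⁰ β = spanSingleton (𝓞 F)⁰ x :=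
      mul_left_cancel₀ (inv_ne_zero h𝔞) (hIβ.symm.trans hIx)
    obtain ⟨z, hz⟩ := spanSingleton_eq_spanSingleton.1 hsx
    replace hz : ((z : 𝓞 F) : F) * β = x := hz
    obtain ⟨ε, ⟨hε, hεz⟩, -⟩ := hE z (hβ.of_mul_right (hz ▸ hx))
    refine ⟨ε, hε, ?_⟩
    ext a
    obtain ⟨α, hα, rfl⟩ := a.exists_mk
    rw [hΨ, hψx, ← hz, mul_assoc, mul_assoc, hεz]
    rw [h𝔞β]
    exact mul_mem_spanSingleton_mul β hα
  · intro ε hε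
    rw [hΨ, mul_one]

/-- The finite identity behind the expansion: the contributions of all torsion points to the
coefficient of the ideal `I` add up to `χ I`. -/
theorem sum_coeff_mul_eq_character (htr : ∀ v : InfinitePlace F, v.IsReal)
    {𝔤 : Ideal (𝓞 F)} (h𝔤 : 𝔤 ≠ ⊥) {χ : Ideal (𝓞 F) → ℂ}
    {T : Finset ((FractionalIdeal (𝓞 F)⁰ F) × (F → ℂ))}
    (hTmem : ∀ q ∈ T, q.1 ≠ 0 ∧ IsTorsChar 𝔤 q.1 q.2)
    (hT : ∀ (𝔟 : FractionalIdeal (𝓞 F)⁰ F) (ψ : F → ℂ), 𝔟 ≠ 0 → IsTorsChar 𝔤 𝔟 ψ →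
      ∃! q : (FractionalIdeal (𝓞 F)⁰ F) × (F → ℂ), q ∈ T ∧
        ∃ x : F, IsTotPos F x ∧ 𝔟 = (spanSingleton (𝓞 F)⁰ x)⁻¹ * q.1 ∧
          ∀ α ∈ 𝔟, ψ α = q.2 (x * α))
    {E : (FractionalIdeal (𝓞 F)⁰ F) × (F → ℂ) → Finset ((𝓞 F)ˣ)}
    (hEpos : ∀ q ∈ T, ∀ ε ∈ E q, IsTotPos F ((ε : 𝓞 F) : F))
    (hE : ∀ q ∈ T, ∀ ε : (𝓞 F)ˣ, IsTotPos F ((ε : 𝓞 F) : F) →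
      ∃! ε' : (𝓞 F)ˣ, ε' ∈ E q ∧
        ∀ α ∈ q.1, q.2 (((ε : 𝓞 F) : F) * α) = q.2 (((ε' : 𝓞 F) : F) * α))
    {R : FractionalIdeal (𝓞 F)⁰ F → Set F}
    (hR1 : ∀ q ∈ T, ∀ β ∈ R q.1, β ∈ q.1 ∧ IsTotPos F β)
    (hR2 : ∀ q ∈ T, ∀ α, α ∈ q.1 → IsTotPos F α →
      ∃! β, β ∈ R q.1 ∧ ∃ ε : (𝓞 F)ˣ, IsTotPos F ((ε : 𝓞 F) : F) ∧
        ((ε : 𝓞 F) : F) * β = α)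
    {B : FractionalIdeal (𝓞 F)⁰ F → Finset F}
    (hB1 : ∀ q ∈ T, ∀ β ∈ B q.1, β ∈ q.1)
    (hB2 : ∀ q ∈ T, ∀ α ∈ q.1, ∃! β, β ∈ B q.1 ∧
      α - β ∈ (𝔤 : FractionalIdeal (𝓞 F)⁰ F) * q.1)
    {χf : FractionalIdeal (𝓞 F)⁰ F → F → ℂ}
    (hχfper : ∀ q ∈ T, ∀ α γ : F, γ ∈ (𝔤 : FractionalIdeal (𝓞 F)⁰ F) * q.1 →
      χf q.1 (α + γ) = χf q.1 α)
    (hχfval : ∀ q ∈ T, ∀ α ∈ q.1, IsTotPos F α → ∀ I : Ideal (𝓞 F),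
      (I : FractionalIdeal (𝓞 F)⁰ F) = q.1⁻¹ * spanSingleton (𝓞 F)⁰ α → χf q.1 α = χ I)
    {I : Ideal (𝓞 F)} (hI : I ≠ ⊥) {e : (FractionalIdeal (𝓞 F)⁰ F) × (F → ℂ) → ℂ}
    (he : ∀ q ∈ T, ∀ β ∈ R q.1,
      (I : FractionalIdeal (𝓞 F)⁰ F) = q.1⁻¹ * spanSingleton (𝓞 F)⁰ β →
        e q = ∑ ε ∈ E q, q.2 (((ε : 𝓞 F) : F) * β))
    (he0 : ∀ q ∈ T, (∀ β ∈ R q.1,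
      (I : FractionalIdeal (𝓞 F)⁰ F) ≠ q.1⁻¹ * spanSingleton (𝓞 F)⁰ β) → e q = 0) :
    ∑ q ∈ T, ((Ideal.absNorm 𝔤 : ℂ)⁻¹ * ∑ β ∈ B q.1, χf q.1 β * q.2 (-β)) * e q = χ I := by
  classical
  set 𝔟 : FractionalIdeal (𝓞 F)⁰ F := (I : FractionalIdeal (𝓞 F)⁰ F)⁻¹ with h𝔟
  have h𝔟0 : 𝔟 ≠ 0 := inv_ne_zero (coeIdeal_ne_zero.2 hI)
  have h1 : (1 : F) ∈ 𝔟 := FractionalIdeal.one_mem_inv_coe_ideal hI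
  have := TorsQuot.finite h𝔤 h𝔟0
  let := Fintype.ofFinite (TorsQuot 𝔤 𝔟)
  have hcard : Fintype.card (TorsQuot 𝔤 𝔟) = Ideal.absNorm 𝔤 := by
    rw [← Nat.card_eq_fintype_card, TorsQuot.card_eq_absNorm 𝔤 h𝔟0]
  have hQ (ψ : AddChar (TorsQuot 𝔤 𝔟) ℂ) :
      ∃ q ∈ T, (∃ x : F, IsTotPos F x ∧ q.1 = spanSingleton (𝓞 F)⁰ x * 𝔟 ∧
        ∀ α hα, ψ (TorsQuot.mk 𝔤 α hα) = q.2 (x * α)) ∧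
        ∀ q' ∈ T, (∃ x : F, IsTotPos F x ∧ q'.1 = spanSingleton (𝓞 F)⁰ x * 𝔟 ∧
          ∀ α hα, ψ (TorsQuot.mk 𝔤 α hα) = q'.2 (x * α)) → q = q' := by
    obtain ⟨ξ, hξ, hξψ⟩ := AddChar.exists_isTorsChar ψ
    obtain ⟨q, ⟨hq, x, hx, hqx, hξx⟩, huniq⟩ := hT 𝔟 ξ h𝔟0 hξ
    refine ⟨q, hq, ⟨x, hx, (eq_spanSingleton_inv_mul_iff (hx.ne_zero htr)).1 hqx,
      fun α hα ↦ by rw [← hξψ α hα, hξx α hα]⟩, ?_⟩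
    rintro q' hq' ⟨x', hx', hqx', hψx'⟩
    exact (huniq q' ⟨hq', x', hx', (eq_spanSingleton_inv_mul_iff (hx'.ne_zero htr)).2 hqx',
      fun α hα ↦ by rw [hξψ α hα, hψx' α hα]⟩).symm
  choose Q hQT hQx hQuniq using hQ
  choose x hxpos hxspan hxψ using hQx
  let X : TorsQuot 𝔤 𝔟 → ℂ := fun a ↦ χf (Q 1).1 (x 1 * a.exists_mk.choose)
  have hX (q) (hq : q ∈ T) (y : F) (hy : IsTotPos F y)
      (hqy : q.1 = spanSingleton (𝓞 F)⁰ y * 𝔟) (b : F) (hb : b ∈ 𝔟) :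
      X (TorsQuot.mk 𝔤 b hb) = χf q.1 (y * b) := by
    obtain ⟨hc, hcb⟩ := (TorsQuot.mk 𝔤 b hb).exists_mk.choose_spec
    rw [TorsQuot.mk_eq_iff] at hcb
    obtain ⟨γ, hγ, hpos⟩ := exists_mem_isTotPos_add h𝔤 hI b
    obtain ⟨J, -, hJ⟩ := exists_coeIdeal_eq_inv_mul_spanSingleton h𝔟0
      (FractionalIdeal.add_mem hb (coeIdeal_mul_le_right _ _ hγ)) (hpos.ne_zero htr)
    rw [h𝔟, inv_inv] at hJ
    rw [inducedFun_mul_eq (hTmem q hq).1 hI (hχfper q hq) (hχfval q hq) hy hqy hb hγ hpos hJ,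
      ← inducedFun_mul_eq (hTmem _ (hQT 1)).1 hI (hχfper _ (hQT 1)) (hχfval _ (hQT 1))
        (hxpos 1) (hxspan 1) hb hγ hpos hJ]
    have hper : x 1 * ((TorsQuot.mk 𝔤 b hb).exists_mk.choose - b) ∈
        (𝔤 : FractionalIdeal (𝓞 F)⁰ F) * (Q 1).1 := by
      rw [hxspan 1, mul_left_comm]
      exact mul_mem_spanSingleton_mul _ hcb
    rw [← hχfper _ (hQT 1) _ _ hper, ← mul_add, add_sub_cancel]
  have hcoeff (ψ : AddChar (TorsQuot 𝔤 𝔟) ℂ) :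
      (Ideal.absNorm 𝔤 : ℂ)⁻¹ * ∑ β ∈ B (Q ψ).1, χf (Q ψ).1 β * (Q ψ).2 (-β) =
        (Fintype.card (TorsQuot 𝔤 𝔟) : ℂ)⁻¹ * ∑ b, X b * ψ (-b) := by
    rw [hcard, sum_reps_eq_sum_torsQuot ((hxpos ψ).ne_zero htr) (hxspan ψ) (hB1 _ (hQT ψ))
      (hB2 _ (hQT ψ)) (G := fun β ↦ χf (Q ψ).1 β * (Q ψ).2 (-β))
      (X := fun b ↦ X b * ψ (-b))]
    intro b hb
    have hnb : -b ∈ 𝔟 := (𝔟 : Submodule (𝓞 F) F).neg_mem hb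
    have hneg : -TorsQuot.mk 𝔤 b hb = TorsQuot.mk 𝔤 (-b) hnb := rfl
    rw [hX _ (hQT ψ) _ (hxpos ψ) (hxspan ψ), hneg, hxψ, mul_neg]
  have hXone : X (TorsQuot.mk 𝔤 1 h1) = χ I := by
    rw [hX _ (hQT 1) _ (hxpos 1) (hxspan 1), mul_one]
    refine hχfval _ (hQT 1) _ ?_ (hxpos 1) I
      ((coeIdeal_eq_inv_mul_spanSingleton_iff (hTmem _ (hQT 1)).1 hI).2 (hxspan 1))
    have := mul_mem_spanSingleton_mul (x 1) h1
    rwa [mul_one, ← hxspan 1] at this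
  rw [← hXone, ← AddChar.sum_fourier_inversion X (TorsQuot.mk 𝔤 1 h1),
    ← Finset.sum_fiberwise_of_maps_to (g := Q) (t := T) fun ψ _ ↦ hQT ψ]
  refine Finset.sum_congr rfl fun q hq ↦ ?_
  have hfiber : e q = ∑ ψ with Q ψ = q, ψ (TorsQuot.mk 𝔤 1 h1) := by
    by_cases hex : ∃ β ∈ R q.1, (I : FractionalIdeal (𝓞 F)⁰ F) =
        q.1⁻¹ * spanSingleton (𝓞 F)⁰ β
    · obtain ⟨β, hβ, hIβ⟩ := hex
      rw [he q hq β hβ hIβ]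
      refine sum_unit_orbit_eq_sum_fiber htr hI (hTmem q hq).1 (hTmem q hq).2 (hEpos q hq)
        (hE q hq) (hR1 q hq β hβ).2 hIβ _ fun ψ ↦ ?_
      rw [Finset.mem_filter_univ]
      refine ⟨?_, fun h ↦ hQuniq ψ q hq h⟩
      rintro rfl
      exact ⟨x ψ, hxpos ψ, hxspan ψ, hxψ ψ⟩
    · push Not at hex
      rw [he0 q hq hex, eq_comm]
      refine Finset.sum_eq_zero fun ψ hψ ↦ ?_
      rw [Finset.mem_filter_univ] at hψ
      subst hψ
      have hmem := mul_mem_spanSingleton_mul (x ψ) h1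
      rw [mul_one, ← hxspan ψ] at hmem
      obtain ⟨β, ⟨hβ, ε, -, hε⟩, -⟩ := hR2 _ hq _ hmem (hxpos ψ)
      refine absurd ?_ (hex β hβ)
      rw [coeIdeal_eq_inv_mul_spanSingleton_iff (hTmem _ hq).1 hI,
        ← spanSingleton_units_mul ε, hε]
      exact hxspan ψ
  rw [hfiber, Finset.mul_sum]
  refine Finset.sum_congr rfl fun ψ hψ ↦ ?_
  rw [Finset.mem_filter_univ] at hψ
  subst hψ
  rw [hcoeff]

end Expansion

/-- **Expansion of a Hecke `L`-function in Lerch zeta functions.**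
`F` totally real, `𝔤 ≠ 0` an integral ideal, `χ` a finite Hecke character mod `𝔤`
(extended by zero to all ideals).  Let `T` be a complete system of representatives
`(𝔞, ξ)` for `𝒯[𝔤]`, the set of `F_+^×`-orbits of `𝔤`-torsion points over all
fractional ideals; for each such pair let `E (𝔞,ξ)` be a set of representatives of
`Δ_ξ\Δ`, `R 𝔞` a set of representatives of `Δ\𝔞_+`, `B 𝔞` a set of representatives
of `𝔞/𝔤𝔞`, and `χf 𝔞` the induced function `χ_𝔞`.  Then for `Re s > 1`,
`L(χ, s) = ∑_{ξ ∈ 𝒯[𝔤]} c_χ(ξ) ℒ(ξΔ, s)`. -/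
theorem heckeL_eq_sum_c_mul_lerchZeta
    (F : Type*) [Field F] [NumberField F]
    (htr : ∀ v : NumberField.InfinitePlace F, v.IsReal)
    (𝔤 : Ideal (𝓞 F)) (h𝔤 : 𝔤 ≠ ⊥)
    -- `χ`, a finite Hecke character mod `𝔤` on ideals, extended by zero:
    (χ : Ideal (𝓞 F) → ℂ)
    (hχmul : ∀ I J, χ (I * J) = χ I * χ J)
    (hχzero : ∀ I, ¬ IsCoprime I 𝔤 → χ I = 0)
    (hχne : ∀ I, IsCoprime I 𝔤 → χ I ≠ 0)
    (hχray : ∀ y : 𝓞 F, IsTotPos F (y : F) → y - 1 ∈ 𝔤 → χ (Ideal.span {y}) = 1)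
    -- `T`, a complete set of representatives of `𝒯[𝔤] = (⨆_𝔞 𝕋^𝔞[𝔤])/F_+^×`:
    (T : Finset ((FractionalIdeal (𝓞 F)⁰ F) × (F → ℂ)))
    (hTmem : ∀ q ∈ T, q.1 ≠ 0 ∧ IsTorsChar 𝔤 q.1 q.2)
    (hT : ∀ (𝔟 : FractionalIdeal (𝓞 F)⁰ F) (ψ : F → ℂ), 𝔟 ≠ 0 → IsTorsChar 𝔤 𝔟 ψ →
      ∃! q : (FractionalIdeal (𝓞 F)⁰ F) × (F → ℂ), q ∈ T ∧
        ∃ x : F, IsTotPos F x ∧ 𝔟 = (spanSingleton (𝓞 F)⁰ x)⁻¹ * q.1 ∧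
          ∀ α ∈ 𝔟, ψ α = q.2 (x * α))
    -- for each `(𝔞, ξ) ∈ T`, a set `E (𝔞,ξ)` of representatives of `Δ_ξ\Δ`:
    (E : (FractionalIdeal (𝓞 F)⁰ F) × (F → ℂ) → Finset ((𝓞 F)ˣ))
    (hEpos : ∀ q ∈ T, ∀ ε ∈ E q, IsTotPos F ((ε : 𝓞 F) : F))
    (hE : ∀ q ∈ T, ∀ ε : (𝓞 F)ˣ, IsTotPos F ((ε : 𝓞 F) : F) →
      ∃! ε' : (𝓞 F)ˣ, ε' ∈ E q ∧
        ∀ α ∈ q.1, q.2 (((ε : 𝓞 F) : F) * α) = q.2 (((ε' : 𝓞 F) : F) * α))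
    -- for each `𝔞`, a set `R 𝔞` of representatives of `Δ\𝔞_+`:
    (R : FractionalIdeal (𝓞 F)⁰ F → Set F)
    (hR1 : ∀ q ∈ T, ∀ β ∈ R q.1, β ∈ q.1 ∧ IsTotPos F β)
    (hR2 : ∀ q ∈ T, ∀ α, α ∈ q.1 → IsTotPos F α →
      ∃! β, β ∈ R q.1 ∧ ∃ ε : (𝓞 F)ˣ, IsTotPos F ((ε : 𝓞 F) : F) ∧
        ((ε : 𝓞 F) : F) * β = α)
    -- for each `𝔞`, a set `B 𝔞` of representatives of `𝔞/𝔤𝔞`: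
    (B : FractionalIdeal (𝓞 F)⁰ F → Finset F)
    (hB1 : ∀ q ∈ T, ∀ β ∈ B q.1, β ∈ q.1)
    (hB2 : ∀ q ∈ T, ∀ α ∈ q.1, ∃! β, β ∈ B q.1 ∧
      α - β ∈ (𝔤 : FractionalIdeal (𝓞 F)⁰ F) * q.1)
    -- the induced functions `χ_𝔞`:
    (χf : FractionalIdeal (𝓞 F)⁰ F → F → ℂ)
    (hχfper : ∀ q ∈ T, ∀ α γ : F, γ ∈ (𝔤 : FractionalIdeal (𝓞 F)⁰ F) * q.1 →
      χf q.1 (α + γ) = χf q.1 α)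
    (hχfval : ∀ q ∈ T, ∀ α ∈ q.1, IsTotPos F α → ∀ I : Ideal (𝓞 F),
      (I : FractionalIdeal (𝓞 F)⁰ F) = q.1⁻¹ * spanSingleton (𝓞 F)⁰ α → χf q.1 α = χ I)
    (s : ℂ) (hs : 1 < s.re) :
    (∑' I : {I : Ideal (𝓞 F) // I ≠ ⊥}, χ I.1 * (Ideal.absNorm I.1 : ℂ) ^ (-s)) =
      ∑ q ∈ T,
        ((Ideal.absNorm 𝔤 : ℂ)⁻¹ * ∑ β ∈ B q.1, χf q.1 β * q.2 (-β)) *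
          ∑' β : R q.1, (∑ ε ∈ E q, q.2 (((ε : 𝓞 F) : F) * (β : F))) *
            (absNorm (q.1⁻¹ * spanSingleton (𝓞 F)⁰ (β : F)) : ℂ) ^ (-s) := by
  have hι : ∀ q : (FractionalIdeal (𝓞 F)⁰ F) × (F → ℂ),
      ∃ ι : R q.1 → {I : Ideal (𝓞 F) // I ≠ ⊥}, q ∈ T →
        Function.Injective ι ∧ ∀ β, ((ι β).1 : FractionalIdeal (𝓞 F)⁰ F) =
          q.1⁻¹ * spanSingleton (𝓞 F)⁰ (β : F) := by
    intro q
    by_cases hq : q ∈ T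
    · have hex (β : R q.1) := exists_coeIdeal_eq_inv_mul_spanSingleton (hTmem q hq).1
        (hR1 q hq β β.2).1 ((hR1 q hq β β.2).2.ne_zero htr)
      choose ι hι0 hι using hex
      refine ⟨fun β ↦ ⟨ι β, hι0 β⟩, fun _ ↦ ⟨fun β β' h ↦ Subtype.ext ?_, hι⟩⟩
      refine eq_of_spanSingleton_eq_of_reps (hR1 q hq) (hR2 q hq) β.2 β'.2 ?_
      refine mul_left_cancel₀ (inv_ne_zero (hTmem q hq).1) ?_
      rw [← hι, ← hι, Subtype.mk.inj h]
    · exact ⟨fun _ ↦ ⟨⊤, top_ne_bot⟩, fun h ↦ absurd h hq⟩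
  choose ι hι using hι
  let k (q : (FractionalIdeal (𝓞 F)⁰ F) × (F → ℂ)) (β : R q.1) : ℂ :=
    ∑ ε ∈ E q, q.2 (((ε : 𝓞 F) : F) * (β : F))
  have hterm (q) (hq : q ∈ T) (β : R q.1) :
      k q β * (absNorm (q.1⁻¹ * spanSingleton (𝓞 F)⁰ (β : F)) : ℂ) ^ (-s) =
        k q β * (Ideal.absNorm (ι q β).1 : ℂ) ^ (-s) := by
    rw [← (hι q hq).2 β, coeIdeal_absNorm, Rat.cast_natCast]
  have hextend (q) (hq : q ∈ T) (I : {I : Ideal (𝓞 F) // I ≠ ⊥}) :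
      Function.extend (ι q) (fun β ↦ k q β * (Ideal.absNorm (ι q β).1 : ℂ) ^ (-s)) 0 I =
        Function.extend (ι q) (k q) 0 I * (Ideal.absNorm I.1 : ℂ) ^ (-s) := by
    by_cases hI : ∃ β, ι q β = I
    · obtain ⟨β, rfl⟩ := hI
      rw [(hι q hq).1.extend_apply, (hι q hq).1.extend_apply]
    · rw [Function.extend_apply' _ _ _ hI, Function.extend_apply' _ _ _ hI]
      simp
  have hsum (q) (hq : q ∈ T) :
      Summable fun β : R q.1 ↦ k q β * (Ideal.absNorm (ι q β).1 : ℂ) ^ (-s) := by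
    refine Summable.of_norm_bounded (g := fun β : R q.1 ↦
      (E q).card * (Ideal.absNorm (ι q β).1 : ℝ) ^ (-s.re))
      (((summable_absNorm_rpow F hs).comp_injective (hι q hq).1).mul_left _) fun β ↦ ?_
    rw [norm_mul, Complex.norm_natCast_cpow_of_re_ne_zero _ (by simp; linarith), Complex.neg_re]
    gcongr
    refine (norm_sum_le _ _).trans_eq ?_
    rw [Finset.sum_congr rfl fun ε _ ↦ (hTmem q hq).2.norm_eq_one h𝔤 (hTmem q hq).1
      (units_mul_mem ε (hR1 q hq β β.2).1)]
    simp
  have hpoint (I : {I : Ideal (𝓞 F) // I ≠ ⊥}) :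
      ∑ q ∈ T, ((Ideal.absNorm 𝔤 : ℂ)⁻¹ * ∑ β ∈ B q.1, χf q.1 β * q.2 (-β)) *
        Function.extend (ι q) (k q) 0 I = χ I.1 := by
    refine sum_coeff_mul_eq_character htr h𝔤 hTmem hT hEpos hE hR1 hR2 hB1 hB2 hχfper hχfval
      I.2 (fun q hq β hβ hIβ ↦ ?_) fun q hq hIβ ↦ ?_
    · have : I = ι q ⟨β, hβ⟩ :=
        Subtype.ext (coeIdeal_injective (hIβ.trans ((hι q hq).2 ⟨β, hβ⟩).symm))
      rw [this, (hι q hq).1.extend_apply]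
    · refine Function.extend_apply' _ _ _ ?_
      rintro ⟨β, rfl⟩
      exact hIβ β β.2 ((hι q hq).2 β)
  calc _ = ∑' I : {I : Ideal (𝓞 F) // I ≠ ⊥}, ∑ q ∈ T,
          ((Ideal.absNorm 𝔤 : ℂ)⁻¹ * ∑ β ∈ B q.1, χf q.1 β * q.2 (-β)) *
            Function.extend (ι q) (fun β ↦ k q β * (Ideal.absNorm (ι q β).1 : ℂ) ^ (-s)) 0 I := by
        refine tsum_congr fun I ↦ ?_
        rw [← hpoint I, Finset.sum_mul]
        refine Finset.sum_congr rfl fun q hq ↦ ?_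
        rw [hextend q hq, mul_assoc]
    _ = _ := by
        rw [Summable.tsum_finsetSum fun q hq ↦
          ((summable_extend_zero (hι q hq).1).2 (hsum q hq)).mul_left _]
        refine Finset.sum_congr rfl fun q hq ↦ ?_
        rw [tsum_mul_left, tsum_extend_zero (hι q hq).1, tsum_congr (hterm q hq)]
end

section
/- Let F be a totally real field of degree g, 𝔞 a fractional ideal, σ a g-dimensional cone generated by α ∈ 𝒜_𝔞^g, and 𝒢^𝔞_σ(t) := (∑_{α ∈ P̆_α ∩ 𝔞} t^α) / ∏_{i=1}^g (1−t^{α_i}) the Shintani generating function. Then for any torsion point ξ with ξ(α_i) ≠ 1 for all i, and any multi-index k ∈ ℕ^I, one has ∂^k 𝒢^𝔞_σ(t)|_{t=ξ} = ζ_σ(ξ, −k), where ζ_σ(ξ, s) = ∑_{α ∈ σ̆∩𝔞} ξ(α) α^{-s} is the Shintani zeta function and ∂^k = ∏_τ ∂_τ^{k_τ} with ∂_τ t^α = α^τ t^α. -/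
open scoped nonZeroDivisors
open NumberField

variable {F : Type*} [Field F] [NumberField F]

/-- The vector of real embeddings of `x ∈ F`. -/
def embVec {ι : Type*} (eR : ι → (F →+* ℝ)) (x : F) : ι → ℝ := fun i => eR i x

/-- The closed polyhedral cone generated by the vectors `embVec (αs i)`. -/
def coneSet {ι : Type*} [Fintype ι] {g : ℕ} (eR : ι → (F →+* ℝ)) (αs : Fin g → F) :
    Set (ι → ℝ) :=
  {u | ∃ c : Fin g → ℝ, (∀ i, 0 ≤ c i) ∧ u = ∑ i, c i • embVec eR (αs i)}

/-- The half-open parallelepiped spanned by the `embVec (αs i)`: coefficients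
`0 ≤ c_i < 1`. -/
def parSet {ι : Type*} [Fintype ι] {g : ℕ} (eR : ι → (F →+* ℝ)) (αs : Fin g → F) :
    Set (ι → ℝ) :=
  {u | ∃ c : Fin g → ℝ, (∀ i, 0 ≤ c i ∧ c i < 1) ∧ u = ∑ i, c i • embVec eR (αs i)}

/-- The half-open modification `R̆` relative to the distinguished coordinate `i₀`. -/
def breve {ι : Type*} [DecidableEq ι] (i₀ : ι) (R : Set (ι → ℝ)) : Set (ι → ℝ) :=
  {u | ∃ δ : ℝ, 0 < δ ∧ ∀ δ' : ℝ, 0 < δ' → δ' < δ →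
    Function.update u i₀ (u i₀ - δ') ∈ R}

/-- The coordinate derivation `∂_τ` on functions `ℂ^ι → ℂ`. -/
noncomputable def Dop {ι : Type*} [Fintype ι] [DecidableEq ι] (i : ι)
    (f : (ι → ℂ) → ℂ) : (ι → ℂ) → ℂ :=
  fun z => fderiv ℂ f z (Pi.single i 1)

/-- Iterated derivation `∂^k = ∏_i ∂_i^{k_i}`. -/
noncomputable def Dmulti {ι : Type*} [Fintype ι] [DecidableEq ι] (k : ι → ℕ)
    (f : (ι → ℂ) → ℂ) : (ι → ℂ) → ℂ :=
  (((Finset.univ : Finset ι).toList.map fun i => (Dop i)^[k i]).foldr (· ∘ ·) id) f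

section SeriesEstimates

/-- A family of vectors `β a` in the open positive orthant, all of whose coordinates are
comparable to a common size `L a ≥ 1`, with a summable inverse power of the sizes. -/
structure IsConeFamily {I ι : Type*} (β : I → ι → ℝ) (L : I → ℝ) (K : ℝ) (R : ℕ) : Prop where
  one_le_const : 1 ≤ K
  one_le_size : ∀ a, 1 ≤ L a
  le_size : ∀ a j, β a j ≤ K * L a
  size_le : ∀ a j, L a ≤ K * β a j
  summable_size : Summable fun a => (L a ^ R)⁻¹

/-- The exponential series `∑ c_a β_a^m e^{β_a · z}`. -/
noncomputable def expSeries {I ι : Type*} [Fintype ι] (c : I → ℂ) (β : I → ι → ℝ) (m : ι → ℕ)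
    (z : ι → ℂ) : ℂ :=
  ∑' a, c a * (∏ j, (β a j : ℂ) ^ m j) * Complex.exp (∑ j, (β a j : ℂ) * z j)

open Metric Filter Topology

variable {I ι : Type*} {β : I → ι → ℝ} {L : I → ℝ} {K : ℝ} {R : ℕ}

lemma pow_mul_exp_neg_le (N R : ℕ) {δ x : ℝ} (hδ : 0 < δ) (hx : 0 < x) :
    x ^ N * Real.exp (-(δ * x)) ≤ ((N + R).factorial / δ ^ (N + R)) * (x ^ R)⁻¹ := by
  have h := Real.pow_div_factorial_le_exp (δ * x) (by positivity) (N + R)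
  have hf : (0 : ℝ) < (N + R).factorial := by positivity
  rw [Real.exp_neg, ← div_eq_mul_inv, ← div_eq_mul_inv, div_div, div_le_div_iff₀ (by positivity)
    (by positivity)]
  rw [div_le_iff₀ hf] at h
  calc x ^ N * (δ ^ (N + R) * x ^ R) = (δ * x) ^ (N + R) := by rw [mul_pow, pow_add x]; ring
    _ ≤ _ := by rwa [mul_comm _ (Real.exp _)]

namespace IsConeFamily

lemma pos (h : IsConeFamily β L K R) (a : I) (j : ι) : 0 < β a j := by
  have h1 := h.one_le_size a
  have h2 := h.size_le a j
  have h3 := h.one_le_const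
  by_contra hb
  push Not at hb
  nlinarith

lemma size_pos (h : IsConeFamily β L K R) (a : I) : 0 < L a :=
  zero_lt_one.trans_le (h.one_le_size a)

lemma const_pos (h : IsConeFamily β L K R) : 0 < K :=
  zero_lt_one.trans_le h.one_le_const

lemma summable_pow_mul_exp (h : IsConeFamily β L K R) (N : ℕ) {δ : ℝ} (hδ : 0 < δ) :
    Summable fun a => (K * L a) ^ N * Real.exp (-(δ * L a)) := by
  have hK := h.const_pos
  refine Summable.of_nonneg_of_le (fun a => ?_) (fun a => ?_)
    (h.summable_size.mul_left (K ^ N * ((N + R).factorial / δ ^ (N + R))))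
  · have := h.size_pos a
    positivity
  · rw [mul_pow, mul_assoc, mul_assoc]
    exact mul_le_mul_of_nonneg_left (pow_mul_exp_neg_le N R hδ (h.size_pos a)) (by positivity)

variable [Fintype ι] {c : I → ℂ}

lemma norm_term_le (h : IsConeFamily β L K R) (hc : ∀ a, ‖c a‖ ≤ 1) (m : ι → ℕ) {δ : ℝ}
    {z : ι → ℂ} (a : I) (hz : (∑ j, (β a j : ℂ) * z j).re ≤ -(δ * L a)) :
    ‖c a * (∏ j, (β a j : ℂ) ^ m j) * Complex.exp (∑ j, (β a j : ℂ) * z j)‖ ≤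
      (K * L a) ^ (∑ j, m j) * Real.exp (-(δ * L a)) := by
  rw [norm_mul, norm_mul, Complex.norm_exp, norm_prod]
  have h1 : ∏ j, ‖(β a j : ℂ) ^ m j‖ ≤ (K * L a) ^ (∑ j, m j) := by
    rw [← Finset.prod_pow_eq_pow_sum]
    refine Finset.prod_le_prod (fun j _ => norm_nonneg _) fun j _ => ?_
    rw [norm_pow, Complex.norm_of_nonneg (h.pos a j).le]
    exact pow_le_pow_left₀ (h.pos a j).le (h.le_size a j) _
  have h2 : 0 ≤ ∏ j, ‖(β a j : ℂ) ^ m j‖ := Finset.prod_nonneg fun _ _ => norm_nonneg _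
  refine mul_le_mul ?_ (Real.exp_le_exp.2 hz) (Real.exp_nonneg _) (h2.trans h1)
  calc _ ≤ 1 * ∏ j, ‖(β a j : ℂ) ^ m j‖ := mul_le_mul_of_nonneg_right (hc a) h2
    _ ≤ _ := by rwa [one_mul]

lemma summable_term (h : IsConeFamily β L K R) (hc : ∀ a, ‖c a‖ ≤ 1) (m : ι → ℕ) {δ : ℝ}
    (hδ : 0 < δ) {z : ι → ℂ} (hz : ∀ a, (∑ j, (β a j : ℂ) * z j).re ≤ -(δ * L a)) :
    Summable fun a =>
      c a * (∏ j, (β a j : ℂ) ^ m j) * Complex.exp (∑ j, (β a j : ℂ) * z j) :=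
  Summable.of_norm_bounded (h.summable_pow_mul_exp _ hδ) fun a => h.norm_term_le hc m a (hz a)

variable [DecidableEq ι]

lemma re_sum_le_of_mem_ball (h : IsConeFamily β L K R) (i₀ : ι) {t : ℝ} {z : ι → ℂ}
    (hz : z ∈ ball (Pi.single i₀ (-t : ℂ)) (t / (2 * Fintype.card ι * K ^ 2))) (ht : 0 < t)
    (a : I) : (∑ j, (β a j : ℂ) * z j).re ≤ -(t / (2 * K) * L a) := by
  have hK := h.const_pos
  have hL := h.size_pos a
  have : Nonempty ι := ⟨i₀⟩
  have hg : (0 : ℝ) < Fintype.card ι := by exact_mod_cast Fintype.card_pos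
  set r := t / (2 * Fintype.card ι * K ^ 2) with hr
  set z₀ : ι → ℂ := Pi.single i₀ (-t : ℂ) with hz₀
  have hsplit : (∑ j, (β a j : ℂ) * z j).re
      = (∑ j, β a j * (z j - z₀ j).re) + β a i₀ * (-t) := by
    have h1 : ∑ j, β a j * (z₀ j).re = β a i₀ * (-t) := by
      rw [Finset.sum_eq_single i₀]
      · simp [hz₀]
      · intro j _ hj
        simp [hz₀, hj]
      · simp
    rw [← h1, ← Finset.sum_add_distrib, Complex.re_sum]
    refine Finset.sum_congr rfl fun j _ => ?_
    simp
    ring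
  have hb : ∑ j, β a j * (z j - z₀ j).re ≤ ∑ _j : ι, K * L a * r := by
    refine Finset.sum_le_sum fun j _ => ?_
    have h1 : (z j - z₀ j).re ≤ r :=
      (Complex.re_le_norm _).trans ((norm_le_pi_norm (z - z₀) j).trans
        (by simpa [dist_eq_norm] using (mem_ball.1 hz).le))
    calc β a j * (z j - z₀ j).re ≤ β a j * r := mul_le_mul_of_nonneg_left h1 (h.pos a j).le
      _ ≤ _ := mul_le_mul_of_nonneg_right (h.le_size a j) (by positivity)
  have hc : ∑ _j : ι, K * L a * r = t * L a / (2 * K) := by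
    rw [Finset.sum_const, Finset.card_univ, nsmul_eq_mul, hr]
    field_simp
  have hd : t * L a / K ≤ β a i₀ * t := by
    rw [div_le_iff₀ hK]
    nlinarith [h.size_le a i₀]
  have he : t * L a / K = 2 * (t * L a / (2 * K)) := by field_simp
  have hf : t / (2 * K) * L a = t * L a / (2 * K) := by ring
  rw [hsplit, hf]
  linarith

lemma hasFDerivAt_expSeries (h : IsConeFamily β L K R) (hc : ∀ a, ‖c a‖ ≤ 1) (m : ι → ℕ)
    (i₀ : ι) {t : ℝ} (ht : 0 < t) {z : ι → ℂ}
    (hz : z ∈ ball (Pi.single i₀ (-t : ℂ)) (t / (2 * Fintype.card ι * K ^ 2))) :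
    ∃ f' : (ι → ℂ) →L[ℂ] ℂ, HasFDerivAt (expSeries c β m) f' z ∧
      ∀ i, f' (Pi.single i 1) = expSeries c β (m + Pi.single i 1) z := by
  have hK := h.const_pos
  have : Nonempty ι := ⟨i₀⟩
  have hg : (0 : ℝ) < Fintype.card ι := by exact_mod_cast Fintype.card_pos
  have hδ : 0 < t / (2 * K) := by positivity
  let ℓ : I → (ι → ℂ) →L[ℂ] ℂ := fun a => ∑ j, (β a j : ℂ) • ContinuousLinearMap.proj j
  have hℓ : ∀ a x, ℓ a x = ∑ j, (β a j : ℂ) * x j := fun a x => by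
    simp [ℓ]
  let f' : I → (ι → ℂ) → (ι → ℂ) →L[ℂ] ℂ := fun a z =>
    (c a * (∏ j, (β a j : ℂ) ^ m j) * Complex.exp (∑ j, (β a j : ℂ) * z j)) • ℓ a
  have hnorm : ∀ a, ‖ℓ a‖ ≤ Fintype.card ι * (K * L a) := by
    intro a
    have := h.size_pos a
    refine ContinuousLinearMap.opNorm_le_bound _ (by positivity) fun x => ?_
    rw [hℓ]
    calc _ ≤ ∑ j, ‖(β a j : ℂ) * x j‖ := norm_sum_le _ _
      _ ≤ ∑ _j : ι, K * L a * ‖x‖ := by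
        refine Finset.sum_le_sum fun j _ => ?_
        rw [norm_mul, Complex.norm_of_nonneg (h.pos a j).le]
        exact mul_le_mul (h.le_size a j) (norm_le_pi_norm x j) (norm_nonneg _) (by positivity)
      _ = _ := by simp; ring
  have hbound : ∀ a, ∀ y ∈ ball (Pi.single i₀ (-t : ℂ)) (t / (2 * Fintype.card ι * K ^ 2)),
      ‖f' a y‖ ≤ Fintype.card ι *
        ((K * L a) ^ (∑ j, m j + 1) * Real.exp (-(t / (2 * K) * L a))) := by
    intro a y hy
    rw [norm_smul]
    have := h.size_pos a
    refine (mul_le_mul (h.norm_term_le hc m a (h.re_sum_le_of_mem_ball i₀ hy ht a)) (hnorm a)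
      (norm_nonneg _) (by positivity)).trans_eq ?_
    ring
  have hsum := (h.summable_pow_mul_exp (∑ j, m j + 1) hδ).mul_left (Fintype.card ι : ℝ)
  refine ⟨∑' a, f' a z, ?_, fun i => ?_⟩
  · refine hasFDerivAt_tsum_of_isPreconnected hsum isOpen_ball
      (convex_ball _ _).isPreconnected (fun a y _ => ?_) hbound hz
      (h.summable_term hc m hδ fun a => h.re_sum_le_of_mem_ball i₀ hz ht a) hz
    have hl : HasFDerivAt (fun y : ι → ℂ => ∑ j, (β a j : ℂ) * y j) (ℓ a) y := by
      have := (ℓ a).hasFDerivAt (x := y)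
      exact this.congr_of_eventuallyEq (Eventually.of_forall fun x => (hℓ a x).symm)
    have := hl.cexp.const_mul (c a * ∏ j, (β a j : ℂ) ^ m j)
    rwa [smul_smul] at this
  · have hs : Summable fun a => f' a z :=
      Summable.of_norm_bounded hsum fun a => hbound a z hz
    have := (ContinuousLinearMap.apply ℂ ℂ (Pi.single i 1 : ι → ℂ)).map_tsum hs
    simp only [ContinuousLinearMap.apply_apply] at this
    rw [this, expSeries]
    refine tsum_congr fun a => ?_
    have h1 : ∏ j, (β a j : ℂ) ^ (m + Pi.single i 1 : ι → ℕ) j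
        = (∏ j, (β a j : ℂ) ^ m j) * β a i := by
      simp_rw [Pi.add_apply, pow_add, Finset.prod_mul_distrib]
      congr 1
      rw [Finset.prod_eq_single i]
      · simp
      · intro j _ hj
        simp [hj]
      · simp
    have h2 : ℓ a (Pi.single i 1) = β a i := by
      rw [hℓ, Finset.sum_eq_single i]
      · simp
      · intro j _ hj
        simp [hj]
      · simp
    simp only [f', smul_apply, h1, h2, smul_eq_mul]
    ring

lemma Dop_eventuallyEq_expSeries (h : IsConeFamily β L K R) (hc : ∀ a, ‖c a‖ ≤ 1) {m : ι → ℕ}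
    (i₀ : ι) {t : ℝ} (ht : 0 < t) {f : (ι → ℂ) → ℂ}
    (hf : f =ᶠ[𝓝 (Pi.single i₀ (-t : ℂ))] expSeries c β m) (i : ι) :
    Dop i f =ᶠ[𝓝 (Pi.single i₀ (-t : ℂ))] expSeries c β (m + Pi.single i 1) := by
  have : Nonempty ι := ⟨i₀⟩
  have hg : (0 : ℝ) < Fintype.card ι := by exact_mod_cast Fintype.card_pos
  have hK := h.const_pos
  filter_upwards [hf.fderiv (𝕜 := ℂ), ball_mem_nhds _
    (show 0 < t / (2 * Fintype.card ι * K ^ 2) by positivity)] with z hz hzb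
  obtain ⟨f', hf', hval⟩ := h.hasFDerivAt_expSeries hc m i₀ ht hzb
  rw [Dop, hz, hf'.fderiv, hval]

lemma iterate_Dop_eventuallyEq_expSeries (h : IsConeFamily β L K R) (hc : ∀ a, ‖c a‖ ≤ 1)
    {m : ι → ℕ} (i₀ : ι) {t : ℝ} (ht : 0 < t) {f : (ι → ℂ) → ℂ}
    (hf : f =ᶠ[𝓝 (Pi.single i₀ (-t : ℂ))] expSeries c β m) (i : ι) (n : ℕ) :
    (Dop i)^[n] f =ᶠ[𝓝 (Pi.single i₀ (-t : ℂ))] expSeries c β (m + Pi.single i n) := by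
  induction n with
  | zero => simpa using hf
  | succ n ih =>
    rw [Function.iterate_succ_apply', Pi.single_add, ← add_assoc]
    exact h.Dop_eventuallyEq_expSeries hc i₀ ht ih i

lemma Dmulti_eventuallyEq_expSeries (h : IsConeFamily β L K R) (hc : ∀ a, ‖c a‖ ≤ 1)
    (k : ι → ℕ) (i₀ : ι) {t : ℝ} (ht : 0 < t) {f : (ι → ℂ) → ℂ}
    (hf : f =ᶠ[𝓝 (Pi.single i₀ (-t : ℂ))] expSeries c β 0) :
    Dmulti k f =ᶠ[𝓝 (Pi.single i₀ (-t : ℂ))] expSeries c β k := by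
  have key : ∀ l : List ι, ((l.map fun i => (Dop i)^[k i]).foldr (· ∘ ·) id) f
      =ᶠ[𝓝 (Pi.single i₀ (-t : ℂ))]
        expSeries c β (l.map fun i => (Pi.single i (k i) : ι → ℕ)).sum := by
    intro l
    induction l with
    | nil => simpa using hf
    | cons i l ih =>
      simp only [List.map_cons, List.foldr_cons, Function.comp_apply, List.sum_cons]
      rw [add_comm]
      exact h.iterate_Dop_eventuallyEq_expSeries hc i₀ ht ih i (k i)
  have hk := key (Finset.univ : Finset ι).toList
  rwa [Finset.sum_map_toList, Finset.univ_sum_single] at hk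

end IsConeFamily

lemma analyticAt_Dmulti {ι : Type*} [Fintype ι] [DecidableEq ι] (k : ι → ℕ) {f : (ι → ℂ) → ℂ}
    {z : ι → ℂ} (hf : AnalyticAt ℂ f z) : AnalyticAt ℂ (Dmulti k f) z := by
  have step : ∀ (i : ι) (f : (ι → ℂ) → ℂ), AnalyticAt ℂ f z → AnalyticAt ℂ (Dop i f) z :=
    fun i f hf =>
      ((ContinuousLinearMap.apply ℂ ℂ (Pi.single i 1 : ι → ℂ)).analyticAt _).comp hf.fderiv
  have iter : ∀ (i : ι) (n : ℕ) (f : (ι → ℂ) → ℂ), AnalyticAt ℂ f z →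
      AnalyticAt ℂ ((Dop i)^[n] f) z := by
    intro i n
    induction n with
    | zero => exact fun f hf => hf
    | succ n ih => exact fun f hf => ih _ (step i f hf)
  rw [Dmulti]
  induction (Finset.univ : Finset ι).toList with
  | nil => exact hf
  | cons i l ih => exact iter i (k i) _ ih

lemma Real.rpow_le_rpow_of_abs_le {x y r M : ℝ} (hx : 0 < x) (hxy : x ≤ y) (hxy' : x⁻¹ ≤ y)
    (hy : 1 ≤ y) (hr : |r| ≤ M) : x ^ r ≤ y ^ M := by
  rcases le_total 0 r with h | h
  · exact (Real.rpow_le_rpow hx.le hxy h).trans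
      (Real.rpow_le_rpow_of_exponent_le hy ((le_abs_self r).trans hr))
  · have : x ^ r = x⁻¹ ^ (-r) := by rw [Real.inv_rpow hx.le, Real.rpow_neg hx.le, inv_inv]
    rw [this]
    exact (Real.rpow_le_rpow (inv_nonneg.2 hx.le) hxy' (by linarith)).trans
      (Real.rpow_le_rpow_of_exponent_le hy ((neg_le_abs r).trans hr))

namespace IsConeFamily

variable [Fintype ι] {c : I → ℂ}

lemma norm_dirichlet_le (h : IsConeFamily β L K R) (hc : ∀ a, ‖c a‖ ≤ 1) (i₀ : ι) {M : ℝ}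
    (hM : 0 ≤ M) {s : ι → ℂ} (hs : ∀ j ≠ i₀, |(s j).re| ≤ M)
    (hs₀ : Fintype.card ι * M + R ≤ (s i₀).re) (a : I) :
    ‖c a * ∏ j, (β a j : ℂ) ^ (-(s j))‖ ≤
      K ^ ((s i₀).re + Fintype.card ι * M) * (L a ^ R)⁻¹ := by
  classical
  have hK := h.const_pos
  have hL := h.size_pos a
  have hL1 := h.one_le_size a
  have hK1 := h.one_le_const
  have hKL : 1 ≤ K * L a := one_le_mul_of_one_le_of_one_le hK1 hL1
  have hinv : ∀ j, (β a j)⁻¹ ≤ K / L a := fun j => by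
    rw [inv_eq_one_div, div_le_div_iff₀ (h.pos a j) hL, one_mul]
    exact h.size_le a j
  have hKL' : K / L a ≤ K * L a := by
    rw [div_le_iff₀ hL]
    nlinarith [mul_le_mul hL1 hL1 zero_le_one hL.le]
  have hσ : 0 ≤ (s i₀).re := le_trans (by positivity) hs₀
  have hfac : ∀ j, ‖(β a j : ℂ) ^ (-(s j))‖ = β a j ^ (-(s j).re) := fun j => by
    rw [Complex.norm_cpow_eq_rpow_re_of_pos (h.pos a j), Complex.neg_re]
  have h1 : ∏ j ∈ Finset.univ.erase i₀, ‖(β a j : ℂ) ^ (-(s j))‖ ≤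
      (K * L a) ^ (Fintype.card ι * M) := by
    calc _ ≤ ∏ _j ∈ Finset.univ.erase i₀, (K * L a) ^ M := by
          refine Finset.prod_le_prod (fun _ _ => norm_nonneg _) fun j hj => ?_
          rw [hfac]
          exact Real.rpow_le_rpow_of_abs_le (h.pos a j) (h.le_size a j) ((hinv j).trans hKL') hKL
            (by rw [abs_neg]; exact hs j (Finset.ne_of_mem_erase hj))
      _ = (K * L a) ^ (((Finset.univ.erase i₀).card : ℝ) * M) := by
          rw [Finset.prod_const, mul_comm _ M, Real.rpow_mul_natCast (by positivity)]
      _ ≤ _ := by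
          refine Real.rpow_le_rpow_of_exponent_le hKL (mul_le_mul_of_nonneg_right ?_ hM)
          exact_mod_cast Finset.card_le_card (Finset.subset_univ _)
  have h2 : ‖(β a i₀ : ℂ) ^ (-(s i₀))‖ ≤ (K / L a) ^ (s i₀).re := by
    rw [hfac, Real.rpow_neg (h.pos a i₀).le, ← Real.inv_rpow (h.pos a i₀).le]
    exact Real.rpow_le_rpow (inv_nonneg.2 (h.pos a i₀).le) (hinv i₀) hσ
  rw [norm_mul, norm_prod, ← Finset.mul_prod_erase _ _ (Finset.mem_univ i₀)]
  calc _ ≤ 1 * ((K / L a) ^ (s i₀).re * (K * L a) ^ (Fintype.card ι * M)) := by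
        refine mul_le_mul (hc a) (mul_le_mul h2 h1 (Finset.prod_nonneg fun _ _ => norm_nonneg _)
          (by positivity)) ?_ zero_le_one
        exact mul_nonneg (norm_nonneg _) (Finset.prod_nonneg fun _ _ => norm_nonneg _)
    _ = K ^ ((s i₀).re + Fintype.card ι * M) * L a ^ (-((s i₀).re - Fintype.card ι * M)) := by
        rw [Real.div_rpow hK.le hL.le, Real.mul_rpow hK.le hL.le, Real.rpow_add hK,
          neg_sub, Real.rpow_sub hL]
        ring
    _ ≤ _ := by
        refine mul_le_mul_of_nonneg_left ?_ (by positivity)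
        rw [← Real.rpow_natCast, ← Real.rpow_neg hL.le]
        exact Real.rpow_le_rpow_of_exponent_le hL1 (by linarith)

/-- The continuation of the Dirichlet series is still given by the series when one coordinate
of `s` is large compared to the others. -/
lemma eq_tsum_of_large (h : IsConeFamily β L K R) (hc : ∀ a, ‖c a‖ ≤ 1)
    {A : (ι → ℂ) → ℂ} (hA : Differentiable ℂ A)
    (hA_eq : ∀ s : ι → ℂ, (∀ i, 1 < (s i).re) →
      A s = ∑' a, c a * ∏ j, (β a j : ℂ) ^ (-(s j)))
    (i₀ : ι) {M : ℝ} (hM : 0 ≤ M) {s : ι → ℂ} (hs : ∀ j ≠ i₀, 2 + 2 * ‖s j - 2‖ ≤ M)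
    (hs₀ : Fintype.card ι * M + R ≤ (s i₀).re) (hs₁ : 1 < (s i₀).re) :
    A s = ∑' a, c a * ∏ j, (β a j : ℂ) ^ (-(s j)) := by
  classical
  let p : ℂ → ι → ℂ := fun v => Function.update (fun j => 2 + v * (s j - 2)) i₀ (s i₀)
  have hp₀ : ∀ v, p v i₀ = s i₀ := fun v => by simp [p]
  have hp : ∀ v, ∀ j ≠ i₀, p v j = 2 + v * (s j - 2) := fun v j hj => by simp [p, hj]
  have hpd : ∀ j, Differentiable ℂ fun v => p v j := by
    intro j
    by_cases hj : j = i₀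
    · subst hj
      simp only [hp₀]
      fun_prop
    · simp only [hp _ j hj]
      fun_prop
  have hpd' : Differentiable ℂ p := differentiable_pi.2 hpd
  have hp1 : p 1 = s := by
    funext j
    by_cases hj : j = i₀
    · subst hj
      exact hp₀ 1
    · rw [hp 1 j hj]
      ring
  have hbd : ∀ v ∈ ball (0 : ℂ) 2, ∀ j ≠ i₀, |(p v j).re| ≤ M := by
    intro v hv j hj
    rw [hp v j hj]
    refine (Complex.abs_re_le_norm _).trans ((norm_add_le _ _).trans ((hs j hj).trans' ?_))
    rw [norm_mul]
    have := mem_ball_zero_iff.1 hv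
    have h2 : ‖(2 : ℂ)‖ = 2 := by simp
    rw [h2]
    gcongr
  have hser : DifferentiableOn ℂ (fun v => ∑' a, c a * ∏ j, (β a j : ℂ) ^ (-(p v j)))
      (ball 0 2) := by
    refine Complex.differentiableOn_tsum_of_summable_norm (h.summable_size.mul_left
      (K ^ ((s i₀).re + Fintype.card ι * M))) (fun a => ?_) isOpen_ball fun a v hv => ?_
    · refine Differentiable.differentiableOn ?_
      refine (Differentiable.fun_finsetProd fun j _ => ?_).const_mul _
      exact (hpd j).neg.const_cpow (Or.inl (Complex.ofReal_ne_zero.2 (h.pos a j).ne'))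
    · have := h.norm_dirichlet_le hc i₀ hM (hbd v hv) (by rwa [hp₀]) a
      rwa [hp₀] at this
  have hev : (fun v => A (p v)) =ᶠ[𝓝 0] fun v => ∑' a, c a * ∏ j, (β a j : ℂ) ^ (-(p v j)) := by
    have : ∀ᶠ v in 𝓝 (0 : ℂ), ∀ j, 1 < (p v j).re := by
      refine eventually_all.2 fun j => ?_
      have hcont : ContinuousAt (fun v => (p v j).re) 0 :=
        Complex.continuous_re.continuousAt.comp (hpd j).continuous.continuousAt
      refine hcont.eventually (lt_mem_nhds (show 1 < (p 0 j).re from ?_))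
      by_cases hj : j = i₀
      · subst hj
        rwa [hp₀]
      · rw [hp _ j hj]
        norm_num
    filter_upwards [this] with v hv using hA_eq _ hv
  have := ((hA.comp hpd').differentiableOn.analyticOnNhd
    isOpen_ball).eqOn_of_preconnected_of_eventuallyEq (hser.analyticOnNhd isOpen_ball)
    (convex_ball _ _).isPreconnected (mem_ball_self two_pos) hev
    (show (1 : ℂ) ∈ ball (0 : ℂ) 2 by simp)
  simpa only [Function.comp_apply, hp1] using this

variable [DecidableEq ι]

lemma prod_cpow_neg_eq_div (h : IsConeFamily β L K R) (k : ι → ℕ) (i₀ : ι) (w : ℂ) (a : I) :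
    ∏ j, (β a j : ℂ) ^ (-(-(k j : ℂ) + (Pi.single i₀ w : ι → ℂ) j)) =
      (∏ j, (β a j : ℂ) ^ k j) / (β a i₀ : ℂ) ^ w := by
  have hne : ∀ j, (β a j : ℂ) ≠ 0 := fun j => Complex.ofReal_ne_zero.2 (h.pos a j).ne'
  have h1 : ∏ j, (β a j : ℂ) ^ (Pi.single i₀ w : ι → ℂ) j = (β a i₀ : ℂ) ^ w := by
    rw [Finset.prod_eq_single i₀]
    · simp
    · intro j _ hj
      simp [hj]
    · simp
  rw [← h1, ← Finset.prod_div_distrib]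
  refine Finset.prod_congr rfl fun j _ => ?_
  rw [neg_add, neg_neg, Complex.cpow_add _ _ (hne j), Complex.cpow_neg, Complex.cpow_natCast,
    div_eq_mul_inv]

lemma re_sum_single_le (h : IsConeFamily β L K R) (i₀ : ι) {t : ℝ} (ht : 0 ≤ t) (a : I) :
    (∑ j, (β a j : ℂ) * (Pi.single i₀ (-t : ℂ) : ι → ℂ) j).re ≤ -(t / K * L a) := by
  rw [Finset.sum_eq_single i₀ (fun j _ hj => by simp [hj]) (by simp)]
  have := h.size_le a i₀
  have hK := h.const_pos
  have h1 : t / K * L a ≤ t / K * (K * β a i₀) := by gcongr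
  have h2 : t / K * (K * β a i₀) = t * β a i₀ := by field_simp
  simp
  linarith

/-- On the ray `-t e_{i₀}` the exponential series decays exponentially. -/
lemma expSeries_isBigO_exp (h : IsConeFamily β L K R) (hc : ∀ a, ‖c a‖ ≤ 1) (k : ι → ℕ)
    (i₀ : ι) :
    (fun t : ℝ => expSeries c β k (Pi.single i₀ (-t : ℂ))) =O[atTop]
      fun t => Real.exp (-(1 / (2 * K)) * t) := by
  have hK := h.const_pos
  have hs := h.summable_pow_mul_exp (∑ j, k j) (δ := 1 / (2 * K)) (by positivity)
  refine Asymptotics.IsBigO.of_bound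
    (∑' a, (K * L a) ^ (∑ j, k j) * Real.exp (-(1 / (2 * K) * L a))) ?_
  filter_upwards [eventually_ge_atTop 1] with t ht
  rw [Real.norm_of_nonneg (Real.exp_nonneg _), ← tsum_mul_right]
  refine tsum_of_norm_bounded (hs.mul_right _).hasSum fun a => ?_
  refine (h.norm_term_le hc k (δ := t / K) a (h.re_sum_single_le i₀ (by linarith) a)).trans ?_
  have hL := h.one_le_size a
  have hL0 := h.size_pos a
  rw [mul_assoc, ← Real.exp_add]
  refine mul_le_mul_of_nonneg_left (Real.exp_le_exp.2 ?_) (by positivity)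
  have h1 : 1 / (2 * K) * L a ≤ 1 / (2 * K) * (t * L a) := by
    gcongr
    nlinarith
  have h2 : 1 / (2 * K) * t ≤ 1 / (2 * K) * (t * L a) := by
    gcongr
    nlinarith
  have h3 : t / K * L a = 1 / (2 * K) * (t * L a) + 1 / (2 * K) * (t * L a) := by
    field_simp
    ring
  linarith

/-- The value at `-k` of the continued Dirichlet series is the `k`-th derivative at `0` of the
associated exponential series. -/
theorem Dmulti_zero_eq [Countable I] (h : IsConeFamily β L K R) (hc : ∀ a, ‖c a‖ ≤ 1)
    {A : (ι → ℂ) → ℂ} (hA : Differentiable ℂ A)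
    (hA_eq : ∀ s : ι → ℂ, (∀ i, 1 < (s i).re) →
      A s = ∑' a, c a * ∏ j, (β a j : ℂ) ^ (-(s j)))
    (i₀ : ι) {H : (ι → ℂ) → ℂ} (hH0 : AnalyticAt ℂ H 0)
    (hH : ∀ t : ℝ, 0 < t → H =ᶠ[𝓝 (Pi.single i₀ (-t : ℂ))] expSeries c β 0) (k : ι → ℕ) :
    Dmulti k H 0 = A fun i => -(k i : ℂ) := by
  have hK := h.const_pos
  have : Nonempty ι := ⟨i₀⟩
  have hg : (0 : ℝ) < Fintype.card ι := by exact_mod_cast Fintype.card_pos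
  let S : ℂ → ι → ℂ := fun w j => -(k j : ℂ) + (Pi.single i₀ w : ι → ℂ) j
  let G : ℝ → ℂ := fun t => Dmulti k H (Pi.single i₀ (-t : ℂ))
  set G₀ := Dmulti k H 0 with hG₀
  have hline : ∀ t : ℝ, DifferentiableAt ℝ (fun t : ℝ => (Pi.single i₀ (-t : ℂ) : ι → ℂ)) t := by
    intro t
    refine differentiableAt_pi.2 fun j => ?_
    by_cases hj : j = i₀
    · subst hj
      simp only [Pi.single_eq_same]
      exact Complex.ofRealCLM.differentiableAt.neg
    · simp only [Pi.single_eq_of_ne hj]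
      fun_prop
  have hDm : ∀ t : ℝ, 0 < t →
      Dmulti k H =ᶠ[𝓝 (Pi.single i₀ (-t : ℂ))] expSeries c β k := fun t ht =>
    h.Dmulti_eventuallyEq_expSeries hc k i₀ ht (hH t ht)
  have hGval : ∀ t : ℝ, 0 < t → G t = expSeries c β k (Pi.single i₀ (-t : ℂ)) :=
    fun t ht => (hDm t ht).eq_of_nhds
  have hGcont : ContinuousOn G (Set.Ioi 0) := by
    intro t ht
    have ht : 0 < t := ht
    obtain ⟨f', hf', -⟩ := h.hasFDerivAt_expSeries hc k i₀ ht
      (mem_ball_self (show 0 < t / (2 * Fintype.card ι * K ^ 2) by positivity))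
    have h1 : ContinuousAt (Dmulti k H) (Pi.single i₀ (-t : ℂ)) :=
      hf'.continuousAt.congr (hDm t ht).symm
    exact (ContinuousAt.comp (f := fun t : ℝ => (Pi.single i₀ (-t : ℂ) : ι → ℂ)) h1
      (hline t).continuousAt).continuousWithinAt
  have hGtop : G =O[atTop] fun t => Real.exp (-(1 / (2 * K)) * t) := by
    refine (h.expSeries_isBigO_exp hc k i₀).congr' ?_ EventuallyEq.rfl
    filter_upwards [eventually_gt_atTop 0] with t ht using (hGval t ht).symm
  have hGzero : (fun t => G t - G₀) =O[𝓝[>] 0] fun t : ℝ => t := by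
    have h0 : (Pi.single i₀ (-((0 : ℝ) : ℂ)) : ι → ℂ) = 0 := by simp
    have h1 : DifferentiableAt ℝ G 0 := by
      have h2 : DifferentiableAt ℝ (Dmulti k H) (Pi.single i₀ (-((0 : ℝ) : ℂ))) := by
        rw [h0]
        exact (analyticAt_Dmulti k hH0).differentiableAt.restrictScalars ℝ
      exact DifferentiableAt.comp (f := fun t : ℝ => (Pi.single i₀ (-t : ℂ) : ι → ℂ)) _ h2
        (hline 0)
    have h3 := h1.isBigO_sub
    have h4 : G 0 = G₀ := by simp only [G, h0, hG₀]
    simp only [h4, sub_zero] at h3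
    exact h3.mono nhdsWithin_le_nhds
  let χ : ℝ → ℂ := Set.indicator (Set.Ioc 0 1) fun _ => (1 : ℂ)
  let f : ℝ → ℂ := fun t => G t - G₀ • χ t
  have hGloc : MeasureTheory.LocallyIntegrableOn G (Set.Ioi 0) :=
    hGcont.locallyIntegrableOn measurableSet_Ioi
  have hχloc : MeasureTheory.LocallyIntegrableOn (fun t => G₀ • χ t) (Set.Ioi 0) := by
    have : MeasureTheory.Integrable χ :=
      (MeasureTheory.integrable_indicator_iff measurableSet_Ioc).2
        (MeasureTheory.integrableOn_const (by simp))
    exact (this.smul G₀).locallyIntegrable.locallyIntegrableOn _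
  have hfloc : MeasureTheory.LocallyIntegrableOn f (Set.Ioi 0) := hGloc.sub hχloc
  have hftop : f =O[atTop] fun t => Real.exp (-(1 / (2 * K)) * t) := by
    refine hGtop.congr' ?_ EventuallyEq.rfl
    filter_upwards [eventually_gt_atTop 1] with t ht
    have : χ t = 0 := Set.indicator_of_notMem (fun h => ht.not_ge h.2) _
    simp [f, this]
  have hfbot : f =O[𝓝[>] 0] fun t : ℝ => t ^ (-(-1 : ℝ)) := by
    refine hGzero.congr' ?_ ?_
    · filter_upwards [Ioc_mem_nhdsGT (zero_lt_one' ℝ)] with t ht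
      have : χ t = 1 := Set.indicator_of_mem ht _
      simp [f, this]
    · exact Eventually.of_forall fun t => by simp
  have hGbot : G =O[𝓝[>] 0] fun t : ℝ => t ^ (-(0 : ℝ)) := by
    have h1 : (fun t : ℝ => t) =O[𝓝[>] 0] fun _ : ℝ => (1 : ℝ) :=
      (continuous_id.continuousAt.tendsto.mono_left nhdsWithin_le_nhds).isBigO_one ℝ
    have h2 := (hGzero.trans h1).add (Asymptotics.isBigO_const_const G₀ (one_ne_zero (α := ℝ)) _)
    simpa using h2
  have hmellin : ∀ w : ℂ, 0 < w.re → mellin G w = mellin f w + G₀ / w := by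
    intro w hw
    have h1 : MellinConvergent G w :=
      mellinConvergent_of_isBigO_rpow_exp (by positivity) hGloc hGtop hGbot hw
    have h2 := hasMellin_one_Ioc hw
    have h3 := hasMellin_const_smul h2.1 G₀
    have h4 := (hasMellin_sub h1 h3.1).2
    rw [h3.2, h2.2] at h4
    have h5 : mellin f w = mellin G w - G₀ • (1 / w) := h4
    rw [h5, smul_eq_mul]
    ring
  set M : ℝ := ∑ j, (2 + 2 * ‖-(k j : ℂ) - 2‖) with hMdef
  have hMnn : 0 ≤ M := Finset.sum_nonneg fun _ _ => by positivity
  set W : ℝ := k i₀ + Fintype.card ι * M + R + 2 with hW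
  have hlarge : ∀ w : ℂ, W < w.re → mellin G w = Complex.Gamma w * A (S w) := by
    intro w hw
    have hS₀ : (S w i₀).re = w.re - k i₀ := by
      simp [S]
      ring
    have hSj : ∀ j ≠ i₀, S w j = -(k j : ℂ) := fun j hj => by simp [S, hj]
    have hSM : ∀ j ≠ i₀, 2 + 2 * ‖S w j - 2‖ ≤ M := fun j hj => by
      rw [hSj j hj]
      exact Finset.single_le_sum (f := fun j => 2 + 2 * ‖-(k j : ℂ) - 2‖)
        (fun _ _ => by positivity) (Finset.mem_univ j)
    have hnn : 0 ≤ Fintype.card ι * M := by positivity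
    have hRnn : (0 : ℝ) ≤ R := R.cast_nonneg
    have hknn : (0 : ℝ) ≤ k i₀ := (k i₀).cast_nonneg
    have hre : Fintype.card ι * M + R ≤ (S w i₀).re := by rw [hS₀]; linarith
    have hre' : 1 < (S w i₀).re := by rw [hS₀]; linarith
    have hterm : ∀ a, c a * ∏ j, (β a j : ℂ) ^ (-(S w j)) =
        c a * (∏ j, (β a j : ℂ) ^ k j) / (β a i₀ : ℂ) ^ w := fun a => by
      rw [h.prod_cpow_neg_eq_div k i₀ w a, mul_div_assoc]
    have hmel := hasSum_mellin (a := fun a => c a * ∏ j, (β a j : ℂ) ^ k j)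
      (p := fun a => β a i₀) (F := G) (s := w) (fun a => Or.inr (h.pos a i₀)) (by linarith)
      (fun t ht => by
        have ht : 0 < t := ht
        rw [hGval t ht]
        refine (h.summable_term hc k (δ := t / K) (by positivity)
          fun a => h.re_sum_single_le i₀ ht.le a).hasSum.congr_fun fun a => ?_
        rw [Finset.sum_eq_single i₀ (fun j _ hj => by simp [hj]) (by simp)]
        simp)
      (by
        refine Summable.of_nonneg_of_le
          (fun a => div_nonneg (norm_nonneg _) (Real.rpow_nonneg (h.pos a i₀).le _)) (fun a => ?_)
          (h.summable_size.mul_left (K ^ ((S w i₀).re + Fintype.card ι * M)))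
        have := h.norm_dirichlet_le hc i₀ hMnn (s := S w) (fun j hj => ?_) hre a
        · rwa [hterm, norm_div, Complex.norm_cpow_eq_rpow_re_of_pos (h.pos a i₀)] at this
        · refine (hSM j hj).trans' ((Complex.abs_re_le_norm _).trans ?_)
          have h1 := norm_add_le (S w j - 2) 2
          have h2 : ‖(2 : ℂ)‖ = 2 := by simp
          rw [sub_add_cancel, h2] at h1
          linarith [norm_nonneg (S w j - 2)])
    rw [← hmel.tsum_eq, h.eq_tsum_of_large hc hA hA_eq i₀ hMnn hSM hre hre', ← tsum_mul_left]
    refine tsum_congr fun a => ?_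
    rw [hterm, mul_div_assoc]
  have hSd : Differentiable ℂ S := by
    refine differentiable_pi.2 fun j => ?_
    by_cases hj : j = i₀
    · subst hj
      simp only [S, Pi.single_eq_same]
      fun_prop
    · simp only [S, Pi.single_eq_of_ne hj]
      fun_prop
  let U : Set ℂ := {w | -1 < w.re}
  have hU : IsOpen U := isOpen_lt continuous_const Complex.continuous_re
  have hUc : IsPreconnected U := (convex_halfSpace_re_gt (-1)).isPreconnected
  have hleft : DifferentiableOn ℂ (fun w => Complex.Gamma (w + 1) * A (S w)) U := by
    intro w hw
    have hw : -1 < w.re := hw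
    refine (DifferentiableAt.mul ?_ ((hA.comp hSd) w)).differentiableWithinAt
    refine DifferentiableAt.comp (f := fun w : ℂ => w + 1) w
      (Complex.differentiableAt_Gamma _ fun m hm => ?_) (by fun_prop)
    have := congrArg Complex.re hm
    simp at this
    have : (0 : ℝ) ≤ m := m.cast_nonneg
    linarith
  have hright : DifferentiableOn ℂ (fun w => w * mellin f w + G₀) U := by
    intro w hw
    have h1 : DifferentiableAt ℂ (mellin f) w :=
      mellin_differentiableAt_of_isBigO_rpow_exp (by positivity) hfloc hftop hfbot hw
    exact ((differentiableAt_id.mul h1).add_const _).differentiableWithinAt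
  have hWnn : 0 ≤ W := by positivity
  have hev : (fun w => Complex.Gamma (w + 1) * A (S w)) =ᶠ[𝓝 ((W + 1 : ℝ) : ℂ)]
      fun w => w * mellin f w + G₀ := by
    have : ∀ᶠ w in 𝓝 ((W + 1 : ℝ) : ℂ), W < w.re :=
      Complex.continuous_re.continuousAt.eventually (lt_mem_nhds (by simp))
    filter_upwards [this] with w hw
    have hw0 : 0 < w.re := by linarith
    have hwne : w ≠ 0 := fun h => by simp [h] at hw0
    have h1 := hlarge w hw
    rw [hmellin w hw0] at h1
    rw [Complex.Gamma_add_one w hwne, mul_assoc, ← h1]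
    field_simp
  have hfin := (hleft.analyticOnNhd hU).eqOn_of_preconnected_of_eventuallyEq
    (hright.analyticOnNhd hU) hUc (show ((W + 1 : ℝ) : ℂ) ∈ U by
      show -1 < ((W + 1 : ℝ) : ℂ).re
      rw [Complex.ofReal_re]
      linarith) hev (show (0 : ℂ) ∈ U by simp [U])
  simpa [S] using hfin.symm

end IsConeFamily

end SeriesEstimates

section HalfOpen

open Filter Topology

/-- Nonnegativity of `c` that persists under an infinitesimal move in the direction `-e`. -/
def HalfOpenNonneg (e c : ℝ) : Prop := (0 < e → 0 < c) ∧ 0 ≤ c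

lemma HalfOpenNonneg.mono {e c c' : ℝ} (h : HalfOpenNonneg e c) (hc : c ≤ c') :
    HalfOpenNonneg e c' :=
  ⟨fun he => (h.1 he).trans_le hc, h.2.trans hc⟩

lemma HalfOpenNonneg.le_one_of_not {e c : ℝ} (h : ¬HalfOpenNonneg e (c - 1)) : c ≤ 1 := by
  by_contra hc
  push Not at hc
  exact h ⟨fun _ => by linarith, by linarith⟩

lemma eventually_sub_mul_pos {c : ℝ} (hc : 0 < c) (e : ℝ) :
    ∀ᶠ δ in 𝓝[>] (0 : ℝ), 0 < c - δ * e := by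
  have : ContinuousAt (fun δ : ℝ => c - δ * e) 0 := by fun_prop
  exact (this.eventually (lt_mem_nhds (show 0 < c - 0 * e by simpa using hc))).filter_mono
    nhdsWithin_le_nhds

lemma eventually_sub_mul_nonneg_iff {e c : ℝ} :
    (∀ᶠ δ in 𝓝[>] (0 : ℝ), 0 ≤ c - δ * e) ↔ HalfOpenNonneg e c := by
  constructor
  · intro h
    refine ⟨fun he => ?_, ?_⟩
    · obtain ⟨δ, hδ, hpos⟩ := (h.and self_mem_nhdsWithin).exists
      have hpos : 0 < δ := hpos
      nlinarith
    · by_contra hc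
      push Not at hc
      obtain ⟨δ, hδ, hδ'⟩ := (h.and (eventually_sub_mul_pos (neg_pos.2 hc) (-e))).exists
      linarith
  · rintro ⟨h1, h2⟩
    rcases h2.eq_or_lt with rfl | h2
    · have he : e ≤ 0 := not_lt.1 fun he => lt_irrefl _ (h1 he)
      filter_upwards [self_mem_nhdsWithin] with δ hδ
      have hδ : 0 < δ := hδ
      nlinarith
    · exact (eventually_sub_mul_pos h2 e).mono fun δ hδ => hδ.le

lemma eventually_sub_mul_lt_one_iff {e c : ℝ} :
    (∀ᶠ δ in 𝓝[>] (0 : ℝ), c - δ * e < 1) ↔ ¬HalfOpenNonneg e (c - 1) := by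
  constructor
  · intro h hc
    obtain ⟨δ, h1, h2⟩ := (h.and (eventually_sub_mul_nonneg_iff.2 hc)).exists
    linarith
  · intro h
    have h1 := HalfOpenNonneg.le_one_of_not h
    rcases h1.eq_or_lt with rfl | h1
    · have he : 0 < e := by
        by_contra he
        exact h ⟨fun h' => absurd h' he, by simp⟩
      filter_upwards [self_mem_nhdsWithin] with δ hδ
      have hδ : 0 < δ := hδ
      nlinarith [mul_pos hδ he]
    · exact (eventually_sub_mul_pos (sub_pos.2 h1) (-e)).mono fun δ hδ => by linarith

lemma HalfOpenNonneg.exists_nat {e c : ℝ} (h : HalfOpenNonneg e c) :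
    ∃ n : ℕ, HalfOpenNonneg e (c - n) ∧ ¬HalfOpenNonneg e (c - n - 1) := by
  classical
  have hex : ∃ n : ℕ, ¬HalfOpenNonneg e (c - n - 1) := by
    obtain ⟨n, hn⟩ := exists_nat_gt c
    exact ⟨n, fun h => by linarith [h.2]⟩
  refine ⟨Nat.find hex, ?_, Nat.find_spec hex⟩
  rcases hn : Nat.find hex with _ | n
  · simpa using h
  · have := Nat.find_min hex (m := n) (by omega)
    push_cast
    rw [← sub_sub]
    exact not_not.1 this

lemma HalfOpenNonneg.nat_le {e x y : ℝ} {n m : ℕ} (hx : ¬HalfOpenNonneg e (x - 1))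
    (hy : HalfOpenNonneg e y) (h : x + n = y + m) : m ≤ n := by
  by_contra hlt
  push Not at hlt
  have : (n : ℝ) + 1 ≤ m := by exact_mod_cast hlt
  exact hx (hy.mono (by linarith))

lemma mem_breve_iff {ι : Type*} [DecidableEq ι] {i₀ : ι} {S : Set (ι → ℝ)} {u : ι → ℝ} :
    u ∈ breve i₀ S ↔ ∀ᶠ δ in 𝓝[>] (0 : ℝ), u - δ • Pi.single i₀ 1 ∈ S := by
  have h : ∀ δ : ℝ, Function.update u i₀ (u i₀ - δ) = u - δ • Pi.single i₀ 1 := by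
    intro δ
    funext j
    by_cases hj : j = i₀
    · subst hj
      simp
    · simp [hj]
  rw [(nhdsGT_basis (0 : ℝ)).eventually_iff]
  simp only [breve, Set.mem_ofPred_eq, h, Set.mem_Ioo, and_imp]

end HalfOpen

section Cone

variable {ι : Type*} {g : ℕ} {eR : ι → (F →+* ℝ)} {αs : Fin g → F}
  {b : Module.Basis (Fin g) ℝ (ι → ℝ)}

lemma apply_eq_sum_repr (hb : ∀ i, b i = embVec eR (αs i)) (u : ι → ℝ) (τ : ι) :
    u τ = ∑ i, b.repr u i * eR τ (αs i) := by
  conv_lhs => rw [← b.sum_repr u]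
  simp [hb, embVec, Finset.sum_apply]

lemma repr_embVec_add_sum (hb : ∀ i, b i = embVec eR (αs i)) (x : F) (n : Fin g → ℕ)
    (i : Fin g) :
    b.repr (embVec eR (x + ∑ j, (n j : F) * αs j)) i = b.repr (embVec eR x) i + n i := by
  have h : embVec eR (x + ∑ j, (n j : F) * αs j) = embVec eR x + ∑ j, (n j : ℝ) • b j := by
    funext τ
    simp [hb, embVec, Finset.sum_apply]
  rw [h, map_add, Finsupp.add_apply, b.repr_sum_self]

variable [Fintype ι]

lemma mem_coneSet_iff (hb : ∀ i, b i = embVec eR (αs i)) {u : ι → ℝ} :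
    u ∈ coneSet eR αs ↔ ∀ i, 0 ≤ b.repr u i := by
  constructor
  · rintro ⟨c, hc, rfl⟩ i
    simp_rw [← hb, b.repr_sum_self]
    exact hc i
  · intro h
    refine ⟨fun i => b.repr u i, h, ?_⟩
    simp_rw [← hb, b.sum_repr]

lemma mem_parSet_iff (hb : ∀ i, b i = embVec eR (αs i)) {u : ι → ℝ} :
    u ∈ parSet eR αs ↔ ∀ i, 0 ≤ b.repr u i ∧ b.repr u i < 1 := by
  constructor
  · rintro ⟨c, hc, rfl⟩ i
    simp_rw [← hb, b.repr_sum_self]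
    exact hc i
  · intro h
    refine ⟨fun i => b.repr u i, h, ?_⟩
    simp_rw [← hb, b.sum_repr]

variable [DecidableEq ι] {i₀ : ι}

lemma mem_breve_coneSet_iff (hb : ∀ i, b i = embVec eR (αs i)) {u : ι → ℝ} :
    u ∈ breve i₀ (coneSet eR αs) ↔
      ∀ i, HalfOpenNonneg (b.repr (Pi.single i₀ 1) i) (b.repr u i) := by
  rw [mem_breve_iff]
  simp only [mem_coneSet_iff hb, Filter.eventually_all, map_sub, map_smul, Finsupp.sub_apply,
    Finsupp.smul_apply, smul_eq_mul, eventually_sub_mul_nonneg_iff]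

lemma mem_breve_parSet_iff (hb : ∀ i, b i = embVec eR (αs i)) {u : ι → ℝ} :
    u ∈ breve i₀ (parSet eR αs) ↔
      ∀ i, HalfOpenNonneg (b.repr (Pi.single i₀ 1) i) (b.repr u i) ∧
        ¬HalfOpenNonneg (b.repr (Pi.single i₀ 1) i) (b.repr u i - 1) := by
  rw [mem_breve_iff]
  simp only [mem_parSet_iff hb, Filter.eventually_all, Filter.eventually_and, map_sub, map_smul,
    Finsupp.sub_apply, Finsupp.smul_apply, smul_eq_mul, eventually_sub_mul_nonneg_iff,
    eventually_sub_mul_lt_one_iff]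

lemma pos_of_mem_breve_coneSet (hb : ∀ i, b i = embVec eR (αs i))
    (hpos : ∀ i (τ : F →+* ℝ), 0 < τ (αs i)) {u : ι → ℝ}
    (hu : u ∈ breve i₀ (coneSet eR αs)) (τ : ι) : 0 < u τ := by
  rw [mem_breve_coneSet_iff hb] at hu
  rw [apply_eq_sum_repr hb u τ]
  refine Finset.sum_pos' (fun i _ => mul_nonneg (hu i).2 (hpos i _).le) ?_
  by_contra hne
  push Not at hne
  have hle : ∀ i, b.repr (Pi.single i₀ 1) i ≤ 0 := by
    intro i
    by_contra hi
    push Not at hi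
    have := hne i (Finset.mem_univ i)
    nlinarith [mul_pos ((hu i).1 hi) (hpos i (eR τ))]
  have h1 := apply_eq_sum_repr hb (Pi.single i₀ 1) i₀
  rw [Pi.single_eq_same] at h1
  have h2 : ∑ i, b.repr (Pi.single i₀ 1) i * eR i₀ (αs i) ≤ 0 :=
    Finset.sum_nonpos fun i _ => mul_nonpos_of_nonpos_of_nonneg (hle i) (hpos i _).le
  linarith

/-- Every element of the half-open cone is uniquely an element of the half-open parallelepiped
plus a combination of the generators with natural coefficients. -/
lemma exists_equiv_breve_coneSet (hb : ∀ i, b i = embVec eR (αs i))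
    (𝔞 : FractionalIdeal (𝓞 F)⁰ F) (hmem : ∀ i, αs i ∈ 𝔞) (i₀ : ι) :
    ∃ e : {α : F | α ∈ 𝔞 ∧ embVec eR α ∈ breve i₀ (parSet eR αs)} × (Fin g → ℕ) ≃
        {α : F | α ∈ 𝔞 ∧ embVec eR α ∈ breve i₀ (coneSet eR αs)},
      ∀ p n, (e (p, n) : F) = p + ∑ j, (n j : F) * αs j := by
  have hsum : ∀ n : Fin g → ℕ, ∑ j, (n j : F) * αs j ∈ 𝔞 := by
    intro n
    refine Submodule.sum_mem (𝔞 : Submodule (𝓞 F) F) fun j _ => ?_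
    rw [← nsmul_eq_mul]
    exact Submodule.smul_of_tower_mem _ (n j) (hmem j)
  let Φ : {α : F | α ∈ 𝔞 ∧ embVec eR α ∈ breve i₀ (parSet eR αs)} × (Fin g → ℕ) →
      {α : F | α ∈ 𝔞 ∧ embVec eR α ∈ breve i₀ (coneSet eR αs)} := fun q =>
    ⟨q.1 + ∑ j, (q.2 j : F) * αs j,
      Submodule.add_mem (𝔞 : Submodule (𝓞 F) F) q.1.2.1 (hsum q.2), by
        rw [mem_breve_coneSet_iff hb]
        intro i
        rw [repr_embVec_add_sum hb]
        exact (((mem_breve_parSet_iff hb).1 q.1.2.2) i).1.mono (by simp)⟩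
  have hΦ : Function.Bijective Φ := by
    constructor
    · rintro ⟨⟨p, hp, hp'⟩, n⟩ ⟨⟨q, hq, hq'⟩, m⟩ h
      have h : p + ∑ j, (n j : F) * αs j = q + ∑ j, (m j : F) * αs j := congrArg Subtype.val h
      rw [mem_breve_parSet_iff hb] at hp' hq'
      have hnm : n = m := by
        funext i
        have hi : b.repr (embVec eR p) i + n i = b.repr (embVec eR q) i + m i := by
          rw [← repr_embVec_add_sum hb, ← repr_embVec_add_sum hb, h]
        exact le_antisymm (HalfOpenNonneg.nat_le (hq' i).2 (hp' i).1 hi.symm)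
          (HalfOpenNonneg.nat_le (hp' i).2 (hq' i).1 hi)
      subst hnm
      have hpq : p = q := add_right_cancel h
      subst hpq
      rfl
    · rintro ⟨x, hx, hx'⟩
      rw [mem_breve_coneSet_iff hb] at hx'
      choose n hn using fun i => (hx' i).exists_nat
      have hr : ∀ i, b.repr (embVec eR (x - ∑ j, (n j : F) * αs j)) i =
          b.repr (embVec eR x) i - n i := fun i => by
        rw [eq_sub_iff_add_eq, ← repr_embVec_add_sum hb, sub_add_cancel]
      refine ⟨(⟨x - ∑ j, (n j : F) * αs j,
        Submodule.sub_mem (𝔞 : Submodule (𝓞 F) F) hx (hsum n), ?_⟩, n), ?_⟩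
      · rw [mem_breve_parSet_iff hb]
        intro i
        rw [hr]
        exact hn i
      · exact Subtype.ext (sub_add_cancel _ _)
  exact ⟨Equiv.ofBijective Φ hΦ, fun p n => rfl⟩

lemma finite_setOf_abs_le {ι : Type*} [Finite ι] {eR : ι → (F →+* ℝ)}
    (htr : ∀ v : NumberField.InfinitePlace F, v.IsReal)
    (heR : Function.Surjective eR) (𝔞 : FractionalIdeal (𝓞 F)⁰ F) (B : ι → ℝ) :
    {x : F | x ∈ 𝔞 ∧ ∀ i, |eR i x| ≤ B i}.Finite := by
  classical
  have := Fintype.ofFinite ι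
  obtain ⟨d, hd, hint⟩ := 𝔞.isFractional
  have hd0 : (d : F) ≠ 0 := by
    have : d ≠ 0 := nonZeroDivisors.ne_zero hd
    simpa using this
  refine Set.Finite.of_finite_image (f := fun x => (d : F) * x) ?_
    (fun x _ y _ h => mul_left_cancel₀ hd0 h)
  refine (Embeddings.finite_of_norm_le F ℂ (∑ i, |eR i d| * |B i|)).subset ?_
  rintro _ ⟨x, ⟨hx, hxB⟩, rfl⟩
  refine ⟨?_, fun φ => ?_⟩
  · obtain ⟨y, hy⟩ := hint x hx
    have : (d : F) * x = (y : F) := by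
      rw [Algebra.smul_def] at hy
      exact hy.symm
    show IsIntegral ℤ ((d : F) * x)
    rw [this]
    exact y.isIntegral_coe
  · have hφ : ComplexEmbedding.IsReal φ := InfinitePlace.isReal_of_mk_isReal (htr _)
    obtain ⟨i, hi⟩ := heR hφ.embedding
    have h1 : ∀ y, ‖φ y‖ = |eR i y| := fun y => by
      rw [hi, ← hφ.coe_embedding_apply, Complex.norm_real, Real.norm_eq_abs]
    rw [h1, map_mul, abs_mul]
    calc |eR i d| * |eR i x| ≤ |eR i d| * |B i| := by
          exact mul_le_mul_of_nonneg_left ((hxB i).trans (le_abs_self _)) (abs_nonneg _)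
      _ ≤ _ := Finset.single_le_sum (f := fun i => |eR i d| * |B i|)
          (fun _ _ => by positivity) (Finset.mem_univ i)

lemma finite_breve_parSet (hb : ∀ i, b i = embVec eR (αs i))
    (htr : ∀ v : NumberField.InfinitePlace F, v.IsReal) (heR : Function.Surjective eR)
    (𝔞 : FractionalIdeal (𝓞 F)⁰ F) (hpos : ∀ i (τ : F →+* ℝ), 0 < τ (αs i)) (i₀ : ι) :
    {α : F | α ∈ 𝔞 ∧ embVec eR α ∈ breve i₀ (parSet eR αs)}.Finite := by
  refine (finite_setOf_abs_le htr heR 𝔞 fun τ => ∑ j, eR τ (αs j)).subset ?_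
  rintro x ⟨hx, hx'⟩
  rw [mem_breve_parSet_iff hb] at hx'
  refine ⟨hx, fun τ => ?_⟩
  have h1 : eR τ x = _ := apply_eq_sum_repr hb (embVec eR x) τ
  rw [h1, abs_of_nonneg (Finset.sum_nonneg fun i _ => mul_nonneg (hx' i).1.2 (hpos i _).le)]
  refine Finset.sum_le_sum fun i _ => ?_
  exact mul_le_of_le_one_left (hpos i _).le (HalfOpenNonneg.le_one_of_not (hx' i).2)

end Cone

section PiSums

lemma summable_norm_prod_pi_and_tsum_eq {𝕜 : Type*} [NormedField 𝕜] [CompleteSpace 𝕜] {g : ℕ}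
    (f : Fin g → ℕ → 𝕜) (hf : ∀ j, Summable fun n => ‖f j n‖) :
    (Summable fun n : Fin g → ℕ => ‖∏ j, f j (n j)‖) ∧
      ∑' n : Fin g → ℕ, ∏ j, f j (n j) = ∏ j, ∑' n, f j n := by
  induction g with
  | zero => exact ⟨(hasSum_fintype _).summable, by simp [tsum_fintype]⟩
  | succ g ih =>
    obtain ⟨ih1, ih2⟩ := ih (fun j => f j.succ) fun j => hf j.succ
    let e := Fin.consEquiv fun _ : Fin (g + 1) => ℕ
    have he : ∀ q : ℕ × (Fin g → ℕ), ∏ j, f j (e q j) = f 0 q.1 * ∏ j, f j.succ (q.2 j) := by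
      intro q
      rw [Fin.prod_univ_succ]
      simp [e, Fin.consEquiv]
    constructor
    · rw [← e.summable_iff]
      refine ((hf 0).mul_norm ih1).congr fun q => ?_
      rw [Function.comp_apply, he]
    · rw [Fin.prod_univ_succ, ← ih2, tsum_mul_tsum_of_summable_norm (hf 0) ih1, ← e.tsum_eq]
      exact tsum_congr he

lemma summable_inv_one_add_sum_pow (g : ℕ) :
    Summable fun n : Fin g → ℕ => ((1 + ∑ j, (n j : ℝ)) ^ (2 * g))⁻¹ := by
  have h0 : Summable fun n : ℕ => ‖(((1 + n : ℝ)) ^ 2)⁻¹‖ := by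
    have := (summable_nat_add_iff 1).2 (Real.summable_nat_pow_inv.2 one_lt_two)
    refine this.norm.congr fun n => ?_
    push_cast
    rw [add_comm]
  have h1 := (summable_norm_prod_pi_and_tsum_eq (g := g)
    (fun _ n => (((1 + n : ℝ)) ^ 2)⁻¹) fun _ => h0).1
  refine Summable.of_nonneg_of_le (fun n => by positivity) (fun n => ?_) h1
  rw [Real.norm_of_nonneg (by positivity), Finset.prod_inv_distrib, pow_mul]
  refine inv_anti₀ (by positivity) ?_
  calc ∏ j, (1 + (n j : ℝ)) ^ 2 ≤ ∏ _j : Fin g, (1 + ∑ j, (n j : ℝ)) ^ 2 := by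
        refine Finset.prod_le_prod (fun _ _ => by positivity) fun j _ => ?_
        gcongr
        exact Finset.single_le_sum (f := fun j => (n j : ℝ)) (fun _ _ => by positivity)
          (Finset.mem_univ j)
    _ = _ := by simp

lemma exists_comparison_const {J : Type*} [Finite J] (f : J → ℝ) (hf : ∀ j, 0 < f j) :
    ∃ K : ℝ, 1 ≤ K ∧ ∀ j, f j ≤ K ∧ 1 ≤ K * f j := by
  have := Fintype.ofFinite J
  have hnn : ∀ j, 0 ≤ f j + (f j)⁻¹ := fun j => by
    have := hf j
    positivity
  refine ⟨1 + ∑ j, (f j + (f j)⁻¹), ?_, fun j => ?_⟩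
  · linarith [Finset.sum_nonneg fun j (_ : j ∈ Finset.univ) => hnn j]
  · have h1 := Finset.single_le_sum (f := fun j => f j + (f j)⁻¹) (fun j _ => hnn j)
      (Finset.mem_univ j)
    have h2 := inv_pos.2 (hf j)
    have h3 := hf j
    refine ⟨by linarith, ?_⟩
    calc 1 = (f j)⁻¹ * f j := (inv_mul_cancel₀ h3.ne').symm
      _ ≤ _ := mul_le_mul_of_nonneg_right (by linarith) h3.le

end PiSums

section Character

variable {𝔞 : FractionalIdeal (𝓞 F)⁰ F} {ξ : F → ℂ}

lemma character_nat_mul (hξadd : ∀ α ∈ 𝔞, ∀ β ∈ 𝔞, ξ (α + β) = ξ α * ξ β) (hξone : ξ 0 = 1)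
    {α : F} (hα : α ∈ 𝔞) (n : ℕ) : ξ ((n : F) * α) = ξ α ^ n := by
  induction n with
  | zero => simpa using hξone
  | succ n ih =>
    have hn : (n : F) * α ∈ 𝔞 := by
      rw [← nsmul_eq_mul]
      exact Submodule.smul_of_tower_mem (𝔞 : Submodule (𝓞 F) F) n hα
    rw [Nat.cast_succ, add_mul, one_mul, hξadd _ hn _ hα, ih, pow_succ]

lemma character_add_sum (hξadd : ∀ α ∈ 𝔞, ∀ β ∈ 𝔞, ξ (α + β) = ξ α * ξ β) (hξone : ξ 0 = 1)
    {g : ℕ} {αs : Fin g → F} (hmem : ∀ i, αs i ∈ 𝔞) {p : F} (hp : p ∈ 𝔞) (n : Fin g → ℕ) :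
    ξ (p + ∑ j, (n j : F) * αs j) = ξ p * ∏ j, ξ (αs j) ^ n j := by
  have hn : ∀ j, (n j : F) * αs j ∈ 𝔞 := fun j => by
    rw [← nsmul_eq_mul]
    exact Submodule.smul_of_tower_mem (𝔞 : Submodule (𝓞 F) F) (n j) (hmem j)
  have key : ∀ t : Finset (Fin g), ∑ j ∈ t, (n j : F) * αs j ∈ 𝔞 ∧
      ξ (∑ j ∈ t, (n j : F) * αs j) = ∏ j ∈ t, ξ (αs j) ^ n j := by
    intro t
    induction t using Finset.induction_on with
    | empty => exact ⟨Submodule.zero_mem (𝔞 : Submodule (𝓞 F) F), by simpa⟩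
    | insert j t hj ih =>
      rw [Finset.sum_insert hj, Finset.prod_insert hj]
      exact ⟨Submodule.add_mem (𝔞 : Submodule (𝓞 F) F) (hn j) ih.1, by
        rw [hξadd _ (hn j) _ ih.1, ih.2, character_nat_mul hξadd hξone (hmem j)]⟩
  rw [hξadd _ hp _ (key _).1, (key _).2]

lemma norm_character_eq_one (hξadd : ∀ α ∈ 𝔞, ∀ β ∈ 𝔞, ξ (α + β) = ξ α * ξ β) (hξone : ξ 0 = 1)
    (hξtors : ∃ n : ℕ, 0 < n ∧ ∀ α ∈ 𝔞, ξ ((n : F) * α) = 1) {α : F} (hα : α ∈ 𝔞) :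
    ‖ξ α‖ = 1 := by
  obtain ⟨n, hn, h⟩ := hξtors
  refine (pow_eq_one_iff_of_nonneg (norm_nonneg _) hn.ne').1 ?_
  rw [← norm_pow, ← character_nat_mul hξadd hξone hα, h α hα, norm_one]

end Character

section Shintani

variable {ι : Type*} [Fintype ι]

lemma analyticAt_cexp_sum_mul (x : ι → ℂ) (z : ι → ℂ) :
    AnalyticAt ℂ (fun z : ι → ℂ => Complex.exp (∑ i, x i * z i)) z := by
  refine AnalyticAt.cexp (Finset.analyticAt_fun_sum _ fun i _ => ?_)
  exact analyticAt_const.mul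
    ((ContinuousLinearMap.proj (R := ℂ) (φ := fun _ : ι => ℂ) i).analyticAt z)

/-- The exponential series over a product index set `P × ℕ^g` is a rational expression in
exponentials, wherever the geometric series involved converge. -/
lemma tsum_prod_geometric {P : Type*} [Finite P] {g : ℕ} (u : P → ℂ) {x : Fin g → ℂ}
    (hx : ∀ j, ‖x j‖ < 1) :
    ∑' q : P × (Fin g → ℕ), u q.1 * ∏ j, x j ^ q.2 j = (∑' p, u p) / ∏ j, (1 - x j) := by
  have := Fintype.ofFinite P
  obtain ⟨h1, h2⟩ := summable_norm_prod_pi_and_tsum_eq (fun j n => x j ^ n) fun j => by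
    simpa [norm_pow] using summable_geometric_of_lt_one (norm_nonneg _) (hx j)
  rw [← tsum_mul_tsum_of_summable_norm (hasSum_fintype _).summable h1, h2, div_eq_mul_inv,
    ← Finset.prod_inv_distrib]
  simp_rw [tsum_geometric_of_norm_lt_one (hx _)]

variable {g : ℕ} {eR : ι → (F →+* ℝ)} {αs : Fin g → F}

/-- The embedded elements `p + ∑ n_j α_j` of the half-open cone form a cone family. -/
lemma exists_isConeFamily {P : Type*} [Finite P] {v : P → F}
    (hv : ∀ p τ, 0 < eR τ (v p)) (hpos : ∀ i (τ : F →+* ℝ), 0 < τ (αs i)) :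
    ∃ K : ℝ, IsConeFamily
      (fun (q : P × (Fin g → ℕ)) τ => eR τ (v q.1 + ∑ j, (q.2 j : F) * αs j))
      (fun q => 1 + ∑ j, (q.2 j : ℝ)) K (2 * g) := by
  obtain ⟨K, hK1, hK⟩ := exists_comparison_const
    (Sum.elim (fun q : P × ι => eR q.2 (v q.1)) fun q : Fin g × ι => eR q.2 (αs q.1)) (by
      rintro (q | q)
      · exact hv q.1 q.2
      · exact hpos q.1 _)
  have hKv : ∀ p τ, eR τ (v p) ≤ K ∧ 1 ≤ K * eR τ (v p) := fun p τ => hK (Sum.inl (p, τ))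
  have hKα : ∀ j τ, eR τ (αs j) ≤ K ∧ 1 ≤ K * eR τ (αs j) := fun j τ => hK (Sum.inr (j, τ))
  have hexp : ∀ (q : P × (Fin g → ℕ)) τ, eR τ (v q.1 + ∑ j, (q.2 j : F) * αs j) =
      eR τ (v q.1) + ∑ j, (q.2 j : ℝ) * eR τ (αs j) := fun q τ => by simp
  refine ⟨K, hK1, fun q => ?_, fun q τ => ?_, fun q τ => ?_, ?_⟩
  · have : 0 ≤ ∑ j, (q.2 j : ℝ) := Finset.sum_nonneg fun _ _ => Nat.cast_nonneg _
    linarith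
  · rw [hexp, mul_add, mul_one, Finset.mul_sum]
    refine add_le_add (hKv _ _).1 (Finset.sum_le_sum fun j _ => ?_)
    rw [mul_comm K]
    exact mul_le_mul_of_nonneg_left (hKα j τ).1 (Nat.cast_nonneg _)
  · rw [hexp, mul_add, Finset.mul_sum]
    refine add_le_add (hKv _ _).2 (Finset.sum_le_sum fun j _ => ?_)
    rw [mul_left_comm]
    exact le_mul_of_one_le_right (Nat.cast_nonneg _) (hKα j τ).2
  · have := Fintype.ofFinite P
    have h := Summable.mul_of_nonneg (f := fun _ : P => (1 : ℝ)) (hasSum_fintype _).summable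
      (summable_inv_one_add_sum_pow g) (fun _ => zero_le_one) (fun n => by positivity)
    simpa using h

end Shintani

/-- **Values of derivatives of the Shintani generating function are Shintani zeta
values.** `F` totally real of degree `g`, `𝔞` a fractional ideal, `σ` a `g`-dimensional
cone generated by `α_1, …, α_g ∈ 𝒜_𝔞`, and `ξ` a torsion point with `ξ(α_i) ≠ 1`.
Writing `t = ξ e^{z}`, the Shintani generating function becomes the function `H` below,
with `∂_τ = ∂/∂z_τ`; the Shintani zeta function `ζ_σ(ξ, s)` is the analytic
continuation `A` of `∑_{α ∈ σ̆∩𝔞} ξ(α) α^{-s}`.  Then for every multi-index `k ∈ ℕ^I`: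
`∂^k 𝒢^𝔞_σ(t)|_{t=ξ} = ζ_σ(ξ, −k)`. -/
theorem shintani_generating_function_derivatives_eq_zeta_values
    (ι : Type*) [Fintype ι] [DecidableEq ι] (g : ℕ) (hg : g = Fintype.card ι)
    (hgdeg : Module.finrank ℚ F = g)
    (htr : ∀ v : NumberField.InfinitePlace F, v.IsReal)
    (eR : ι → (F →+* ℝ)) (heR : Function.Bijective eR)
    (𝔞 : FractionalIdeal (𝓞 F)⁰ F) (h𝔞 : 𝔞 ≠ 0)
    (αs : Fin g → F) (hαs_mem : ∀ i, αs i ∈ 𝔞)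
    (hαs_pos : ∀ i τ, 0 < (τ : F →+* ℝ) (αs i))
    (hαs_ind : LinearIndependent ℝ fun i => embVec eR (αs i))
    (i₀ : ι)
    -- `ξ`, a torsion point of `𝕋^𝔞` with `ξ(α_i) ≠ 1`:
    (ξ : F → ℂ)
    (hξadd : ∀ α ∈ 𝔞, ∀ β ∈ 𝔞, ξ (α + β) = ξ α * ξ β)
    (hξone : ξ 0 = 1)
    (hξtors : ∃ n : ℕ, 0 < n ∧ ∀ α ∈ 𝔞, ξ ((n : F) * α) = 1)
    (hξαs : ∀ i, ξ (αs i) ≠ 1)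
    -- `H z = 𝒢^𝔞_σ(ξ e^z)`, the generating function in the variable `z`:
    (H : (ι → ℂ) → ℂ)
    (hH : ∀ z : ι → ℂ, H z =
      (∑' α : {α : F | α ∈ 𝔞 ∧ embVec eR α ∈ breve i₀ (parSet eR αs)},
          ξ (α : F) * Complex.exp (∑ i, ((eR i (α : F) : ℝ) : ℂ) * z i)) /
        ∏ j, (1 - ξ (αs j) * Complex.exp (∑ i, ((eR i (αs j) : ℝ) : ℂ) * z i)))
    -- `A`, the (entire) analytic continuation of the Shintani zeta series:
    (A : (ι → ℂ) → ℂ) (hA_diff : Differentiable ℂ A)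
    (hA_eq : ∀ s : ι → ℂ, (∀ i, 1 < (s i).re) →
      A s = ∑' α : {α : F | α ∈ 𝔞 ∧ embVec eR α ∈ breve i₀ (coneSet eR αs)},
        ξ (α : F) * ∏ i, ((eR i (α : F) : ℝ) : ℂ) ^ (-(s i)))
    (k : ι → ℕ) :
    Dmulti k H 0 = A fun i => -(k i : ℂ) := by
  classical
  have : Nonempty (Fin g) := by
    have : Nonempty ι := ⟨i₀⟩
    rw [hg]
    exact ⟨⟨0, Fintype.card_pos⟩⟩
  let b := basisOfLinearIndependentOfCardEqFinrank hαs_ind (by simp [hg])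
  have hb : ∀ i, b i = embVec eR (αs i) := fun i => by
    simp [b]
  let P := {α : F | α ∈ 𝔞 ∧ embVec eR α ∈ breve i₀ (parSet eR αs)}
  have hPfin : Finite P :=
    (finite_breve_parSet hb htr heR.surjective 𝔞 hαs_pos i₀).to_subtype
  have := Fintype.ofFinite P
  obtain ⟨e, he⟩ := exists_equiv_breve_coneSet hb 𝔞 hαs_mem i₀
  have hPpos : ∀ (p : P) τ, 0 < eR τ (p : F) := fun p τ => by
    refine pos_of_mem_breve_coneSet (i₀ := i₀) hb hαs_pos (u := embVec eR (p : F)) ?_ τ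
    exact (mem_breve_coneSet_iff hb).2 fun i => ((mem_breve_parSet_iff hb).1 p.2.2 i).1
  obtain ⟨K, hfam⟩ := exists_isConeFamily (eR := eR) (v := fun p : P => (p : F)) hPpos hαs_pos
  refine hfam.Dmulti_zero_eq (c := fun q => ξ (e q)) (fun q => ?_) hA_diff (fun s hs => ?_) i₀
    ?_ (fun t ht => ?_) k
  · exact (norm_character_eq_one hξadd hξone hξtors (e q).2.1).le
  · rw [hA_eq s hs, ← e.tsum_eq]
    exact tsum_congr fun q => by rw [he q.1 q.2]
  · have hH' : H = fun z => _ := funext hH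
    rw [hH']
    simp only [tsum_fintype]
    refine AnalyticAt.div ?_ ?_ ?_
    · exact Finset.analyticAt_fun_sum _ fun p _ =>
        analyticAt_const.mul (analyticAt_cexp_sum_mul _ 0)
    · exact Finset.analyticAt_fun_prod _ fun j _ =>
        analyticAt_const.sub (analyticAt_const.mul (analyticAt_cexp_sum_mul _ 0))
    · refine Finset.prod_ne_zero_iff.2 fun j _ => ?_
      simpa [sub_eq_zero] using (hξαs j).symm
  · have hnhds : ∀ᶠ z in nhds (Pi.single i₀ (-t : ℂ) : ι → ℂ), ∀ j,
        ‖ξ (αs j) * Complex.exp (∑ i, ((eR i (αs j) : ℝ) : ℂ) * z i)‖ < 1 := by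
      refine Filter.eventually_all.2 fun j => ?_
      have hcont : Continuous fun z : ι → ℂ =>
          ‖ξ (αs j) * Complex.exp (∑ i, ((eR i (αs j) : ℝ) : ℂ) * z i)‖ := by fun_prop
      refine hcont.continuousAt.eventually (gt_mem_nhds ?_)
      beta_reduce
      rw [norm_mul, norm_character_eq_one hξadd hξone hξtors (hαs_mem j), one_mul,
        Complex.norm_exp, Real.exp_lt_one_iff,
        Finset.sum_eq_single i₀ (fun j _ hj => by simp [hj]) (by simp)]
      simpa using mul_pos (hαs_pos j (eR i₀)) ht
    filter_upwards [hnhds] with z hz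
    rw [hH, ← tsum_prod_geometric (P := P) _ hz, expSeries]
    refine tsum_congr fun q => ?_
    have hexp : ∑ i, ((eR i ((q.1 : F) + ∑ j, (q.2 j : F) * αs j) : ℝ) : ℂ) * z i =
        ∑ i, ((eR i (q.1 : F) : ℝ) : ℂ) * z i +
          ∑ j, (q.2 j : ℂ) * ∑ i, ((eR i (αs j) : ℝ) : ℂ) * z i := by
      simp_rw [Finset.mul_sum]
      rw [Finset.sum_comm, ← Finset.sum_add_distrib]
      refine Finset.sum_congr rfl fun i _ => ?_
      simp only [map_add, map_sum, map_mul, map_natCast, Complex.ofReal_add, Complex.ofReal_sum,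
        Complex.ofReal_mul, Complex.ofReal_natCast, add_mul, Finset.sum_mul, mul_assoc]
    rw [he q.1 q.2, character_add_sum hξadd hξone hαs_mem q.1.2.1, hexp, Complex.exp_add,
      Complex.exp_sum _ fun j => (q.2 j : ℂ) * ∑ i, ((eR i (αs j) : ℝ) : ℂ) * z i]
    simp_rw [mul_pow, Finset.prod_mul_distrib, ← Complex.exp_nat_mul]
    simp
    ring
end
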